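/- arXiv:2306.01718 — 2 statements merged into one kernel-verified Lean document; each statement's English description precedes it below -/
import Mathlib

section
/- Let F be any field and let T ∈ F^{n} ⊗ F^{n} ⊗ F^{n} be a concise symmetric order-three tensor. Then the asymptotic subrank of T satisfies Q~(T) ≥ n^(1/2). -/
open scoped BigOperators

namespace Paper

variable {F : Type*} [Field F]

/-- Restriction of order-three tensors: `T ≥ S` iff there exist linear maps
(given by matrices `L1, L2, L3`) carrying `T` to `S`. -/
def Restricts {ι1 ι2 ι3 κ1 κ2 κ3 : Type*} [Fintype ι1] [Fintype ι2] [Fintype ι3]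
    (T : ι1 → ι2 → ι3 → F) (S : κ1 → κ2 → κ3 → F) : Prop :=
  ∃ (L1 : κ1 → ι1 → F) (L2 : κ2 → ι2 → F) (L3 : κ3 → ι3 → F),
    ∀ a b c, S a b c = ∑ i, ∑ j, ∑ k, L1 a i * L2 b j * L3 c k * T i j k

/-- The unit (diagonal) tensor `⟨r⟩`. -/
def unitTensor (F : Type*) [Field F] (r : ℕ) : Fin r → Fin r → Fin r → F :=
  fun i j k => if i = j ∧ j = k then 1 else 0

/-- The subrank `Q(T)`: the largest `r` such that `T` restricts to `⟨r⟩`. -/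
noncomputable def subrank {ι1 ι2 ι3 : Type*} [Fintype ι1] [Fintype ι2] [Fintype ι3]
    (T : ι1 → ι2 → ι3 → F) : ℕ :=
  sSup {r : ℕ | Restricts T (unitTensor F r)}

/-- Kronecker (tensor) power `T^{⊠ m}` of an order-three tensor. -/
def kronPow {ι1 ι2 ι3 : Type*} (T : ι1 → ι2 → ι3 → F) (m : ℕ) :
    (Fin m → ι1) → (Fin m → ι2) → (Fin m → ι3) → F :=
  fun x y z => ∏ s : Fin m, T (x s) (y s) (z s)

/-- Asymptotic subrank `Q~(T) = lim_n Q(T^{⊠n})^{1/n} = sup_n Q(T^{⊠n})^{1/n}`. -/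
noncomputable def asympSubrank {ι1 ι2 ι3 : Type*} [Fintype ι1] [Fintype ι2] [Fintype ι3]
    (T : ι1 → ι2 → ι3 → F) : ℝ :=
  ⨆ m : ℕ, (subrank (kronPow T (m + 1)) : ℝ) ^ ((1 : ℝ) / (m + 1))

/-- First flattening of a tensor. -/
def flattening1 {ι1 ι2 ι3 : Type*} (T : ι1 → ι2 → ι3 → F) : Matrix ι1 (ι2 × ι3) F :=
  Matrix.of fun i p => T i p.1 p.2

/-- Second flattening of a tensor. -/
def flattening2 {ι1 ι2 ι3 : Type*} (T : ι1 → ι2 → ι3 → F) : Matrix ι2 (ι1 × ι3) F :=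
  Matrix.of fun j p => T p.1 j p.2

/-- Third flattening of a tensor. -/
def flattening3 {ι1 ι2 ι3 : Type*} (T : ι1 → ι2 → ι3 → F) : Matrix ι3 (ι1 × ι2) F :=
  Matrix.of fun k p => T p.1 p.2 k

/-- A tensor is concise if all three flattening ranks are maximal. -/
noncomputable def Concise {ι1 ι2 ι3 : Type*} [Fintype ι1] [Fintype ι2] [Fintype ι3]
    (T : ι1 → ι2 → ι3 → F) : Prop :=
  (flattening1 T).rank = Fintype.card ι1 ∧
  (flattening2 T).rank = Fintype.card ι2 ∧
  (flattening3 T).rank = Fintype.card ι3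

/-- A tensor has slice rank one if one of its flattenings has rank one. -/
noncomputable def SliceRankOne {ι1 ι2 ι3 : Type*} [Fintype ι1] [Fintype ι2] [Fintype ι3]
    (T : ι1 → ι2 → ι3 → F) : Prop :=
  (flattening1 T).rank = 1 ∨ (flattening2 T).rank = 1 ∨ (flattening3 T).rank = 1

/-- The slice rank `SR(T)`: the least `r` such that `T` is a sum of `r` slice-rank-one
tensors. -/
noncomputable def sliceRank {ι1 ι2 ι3 : Type*} [Fintype ι1] [Fintype ι2] [Fintype ι3]
    (T : ι1 → ι2 → ι3 → F) : ℕ :=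
  sInf {r : ℕ | ∃ f : Fin r → (ι1 → ι2 → ι3 → F),
    (∀ t, SliceRankOne (f t)) ∧ T = ∑ t, f t}

/-- The liminf-asymptotic slice rank. -/
noncomputable def asympSliceRankInf {ι1 ι2 ι3 : Type*} [Fintype ι1] [Fintype ι2] [Fintype ι3]
    (T : ι1 → ι2 → ι3 → F) : ℝ :=
  Filter.liminf (fun m : ℕ => (sliceRank (kronPow T m) : ℝ) ^ ((1 : ℝ) / m)) Filter.atTop

/-- The limsup-asymptotic slice rank. -/
noncomputable def asympSliceRankSup {ι1 ι2 ι3 : Type*} [Fintype ι1] [Fintype ι2] [Fintype ι3]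
    (T : ι1 → ι2 → ι3 → F) : ℝ :=
  Filter.limsup (fun m : ℕ => (sliceRank (kronPow T m) : ℝ) ^ ((1 : ℝ) / m)) Filter.atTop

/-- The max-rank of a matrix subspace. -/
noncomputable def maxrank {m n : Type*} [Fintype n] (𝒜 : Submodule F (Matrix m n F)) : ℕ :=
  sSup {r : ℕ | ∃ A ∈ 𝒜, A.rank = r}

/-- The min-rank of a matrix subspace: the least rank of a nonzero element. -/
noncomputable def minrank {m n : Type*} [Fintype n] (𝒜 : Submodule F (Matrix m n F)) : ℕ :=
  sInf {r : ℕ | ∃ A ∈ 𝒜, A ≠ 0 ∧ A.rank = r}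

section Slices

variable {n1 n2 n3 : ℕ}

/-- Span of the 3-slices, rows indexed by direction 1, columns by direction 2. -/
def span12 (T : Fin n1 → Fin n2 → Fin n3 → F) : Submodule F (Matrix (Fin n1) (Fin n2) F) :=
  Submodule.span F (Set.range fun k : Fin n3 => Matrix.of fun i j => T i j k)

/-- Span of the 3-slices, rows indexed by direction 2, columns by direction 1. -/
def span21 (T : Fin n1 → Fin n2 → Fin n3 → F) : Submodule F (Matrix (Fin n2) (Fin n1) F) :=
  Submodule.span F (Set.range fun k : Fin n3 => Matrix.of fun j i => T i j k)

/-- Span of the 2-slices, rows indexed by direction 1, columns by direction 3. -/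
def span13 (T : Fin n1 → Fin n2 → Fin n3 → F) : Submodule F (Matrix (Fin n1) (Fin n3) F) :=
  Submodule.span F (Set.range fun j : Fin n2 => Matrix.of fun i k => T i j k)

/-- Span of the 2-slices, rows indexed by direction 3, columns by direction 1. -/
def span31 (T : Fin n1 → Fin n2 → Fin n3 → F) : Submodule F (Matrix (Fin n3) (Fin n1) F) :=
  Submodule.span F (Set.range fun j : Fin n2 => Matrix.of fun k i => T i j k)

/-- Span of the 1-slices, rows indexed by direction 2, columns by direction 3. -/
def span23 (T : Fin n1 → Fin n2 → Fin n3 → F) : Submodule F (Matrix (Fin n2) (Fin n3) F) :=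
  Submodule.span F (Set.range fun i : Fin n1 => Matrix.of fun j k => T i j k)

/-- Span of the 1-slices, rows indexed by direction 3, columns by direction 2. -/
def span32 (T : Fin n1 → Fin n2 → Fin n3 → F) : Submodule F (Matrix (Fin n3) (Fin n2) F) :=
  Submodule.span F (Set.range fun i : Fin n1 => Matrix.of fun k j => T i j k)

/-- `Q_1(T)`: max-rank of the span of the 1-slices. -/
noncomputable def Q1 (T : Fin n1 → Fin n2 → Fin n3 → F) : ℕ := maxrank (span23 T)

/-- `Q_2(T)`: max-rank of the span of the 2-slices. -/
noncomputable def Q2 (T : Fin n1 → Fin n2 → Fin n3 → F) : ℕ := maxrank (span13 T)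

/-- `Q_3(T)`: max-rank of the span of the 3-slices. -/
noncomputable def Q3 (T : Fin n1 → Fin n2 → Fin n3 → F) : ℕ := maxrank (span12 T)

end Slices

/-- `p` is the pivot of the matrix `A`: the lexicographically least position of a
nonzero entry. -/
def IsPivot {n1 n2 : ℕ} (A : Matrix (Fin n1) (Fin n2) F) (p : Fin n1 × Fin n2) : Prop :=
  A p.1 p.2 ≠ 0 ∧ ∀ q : Fin n1 × Fin n2, A q.1 q.2 ≠ 0 → p.1 < q.1 ∨ (p.1 = q.1 ∧ p.2 ≤ q.2)

/-- The set of pivots of a matrix subspace (equal to the pivots of any basis with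
pairwise distinct pivots). -/
def pivotSet {n1 n2 : ℕ} (𝒜 : Submodule F (Matrix (Fin n1) (Fin n2) F)) :
    Set (Fin n1 × Fin n2) :=
  {p | ∃ A ∈ 𝒜, IsPivot A p}

/-- `ρ(𝒜)`: the least `r = |S1| + |S2|` such that the pivots of `𝒜` are covered by the
rows `S1` and columns `S2`. -/
noncomputable def rho {n1 n2 : ℕ} (𝒜 : Submodule F (Matrix (Fin n1) (Fin n2) F)) : ℕ :=
  sInf {r : ℕ | ∃ (S1 : Finset (Fin n1)) (S2 : Finset (Fin n2)),
    S1.card + S2.card = r ∧ ∀ p ∈ pivotSet 𝒜, p.1 ∈ S1 ∨ p.2 ∈ S2}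

/-- The border subrank `Q̲(T)`: the largest `r` such that, over Laurent polynomials
in `ε`, some restriction of `T` equals `⟨r⟩ + ε S_1 + ⋯ + ε^t S_t`. -/
noncomputable def borderSubrank {ι1 ι2 ι3 : Type*} [Fintype ι1] [Fintype ι2] [Fintype ι3]
    (T : ι1 → ι2 → ι3 → F) : ℕ :=
  sSup {r : ℕ |
    ∃ (A : Fin r → ι1 → LaurentPolynomial F) (B : Fin r → ι2 → LaurentPolynomial F)
      (C : Fin r → ι3 → LaurentPolynomial F) (t : ℕ)
      (S : Fin t → (Fin r → Fin r → Fin r → F)),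
      ∀ a b c,
        (∑ i, ∑ j, ∑ k, A a i * B b j * C c k * LaurentPolynomial.C (T i j k)) =
          LaurentPolynomial.C (unitTensor F r a b c) +
            ∑ s : Fin t, LaurentPolynomial.T (((s : ℕ) : ℤ) + 1) *
              LaurentPolynomial.C (S s a b c)}

/-- The linear map `A ↦ U * A * V` on rectangular matrices. -/
def conjMap {n1 n2 : ℕ} (U : Matrix (Fin n1) (Fin n1) F) (V : Matrix (Fin n2) (Fin n2) F) :
    Matrix (Fin n1) (Fin n2) F →ₗ[F] Matrix (Fin n1) (Fin n2) F where
  toFun A := U * A * V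
  map_add' A B := by simp [Matrix.mul_add, Matrix.add_mul]
  map_smul' c A := by simp [Matrix.mul_smul, Matrix.smul_mul]

/-- The principal submatrix `A_{J×J}`, where `J ⊆ [min{n1,n2}]` is encoded by the
map `η`. -/
def restrictJJ {n1 n2 jn : ℕ} (η : Fin jn → Fin (min n1 n2))
    (A : Matrix (Fin n1) (Fin n2) F) : Matrix (Fin jn) (Fin jn) F :=
  Matrix.of fun p q =>
    A (Fin.castLE (min_le_left n1 n2) (η p)) (Fin.castLE (min_le_right n1 n2) (η q))

/-- An order-three tensor over `F` of arbitrary format. -/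
structure Tensor3 (F : Type*) [Field F] where
  n1 : ℕ
  n2 : ℕ
  n3 : ℕ
  coef : Fin n1 → Fin n2 → Fin n3 → F

/-- Two tensors are equivalent if each restricts to the other. -/
def Tensor3.Equivalent (T S : Tensor3 F) : Prop :=
  Restricts T.coef S.coef ∧ Restricts S.coef T.coef

/-- A rank-one order-`k` tensor: a tensor product of `k` nonzero vectors. -/
def RankOne {k : ℕ} {ι : Fin k → Type*} (T : ((i : Fin k) → ι i) → F) : Prop :=
  ∃ u : (i : Fin k) → (ι i → F), (∀ i, u i ≠ 0) ∧ ∀ v, T v = ∏ i, u i (v i)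

/-- The tensor rank of an order-`k` tensor. -/
noncomputable def tensorRank {k : ℕ} {ι : Fin k → Type*} (T : ((i : Fin k) → ι i) → F) : ℕ :=
  sInf {r : ℕ | ∃ f : Fin r → (((i : Fin k) → ι i) → F),
    (∀ t, RankOne (f t)) ∧ T = ∑ t, f t}

/-- Kronecker power of an order-`k` tensor. -/
def kronPowK {k : ℕ} {ι : Fin k → Type*} (T : ((i : Fin k) → ι i) → F) (m : ℕ) :
    ((i : Fin k) → (Fin m → ι i)) → F :=
  fun v => ∏ s : Fin m, T fun i => v i s

/-- The asymptotic rank `R~(T) = lim_n R(T^{⊠n})^{1/n} = inf_n R(T^{⊠n})^{1/n}`. -/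
noncomputable def asympRank {k : ℕ} {ι : Fin k → Type*} (T : ((i : Fin k) → ι i) → F) : ℝ :=
  ⨅ m : ℕ, (tensorRank (kronPowK T (m + 1)) : ℝ) ^ ((1 : ℝ) / (m + 1))


theorem card_le_of_restricts_unitTensor {ι1 ι2 ι3 : Type*} [Fintype ι1] [Fintype ι2] [Fintype ι3]
    {T : ι1 → ι2 → ι3 → F} {r : ℕ} (h : Restricts T (unitTensor F r)) :
    r ≤ Fintype.card ι1 := by
  obtain ⟨L1, L2, L3, hL⟩ := h
  have hli : LinearIndependent F L1 := by
    rw [Fintype.linearIndependent_iff]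
    intro c hc b
    have h1 : ∑ a, c a * unitTensor F r a b b = c b := by
      simp [unitTensor]
    rw [← h1]
    have hc' : ∀ i, ∑ a, c a * L1 a i = 0 := fun i => by
      simpa using congrFun hc i
    calc ∑ a, c a * unitTensor F r a b b
        = ∑ a, ∑ i, ∑ j, ∑ k, (c a * L1 a i) * (L2 b j * L3 b k * T i j k) := by
          refine Finset.sum_congr rfl fun a _ => ?_
          rw [hL]
          simp only [Finset.mul_sum]
          refine Finset.sum_congr rfl fun i _ => Finset.sum_congr rfl fun j _ =>
            Finset.sum_congr rfl fun k _ => by ring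
      _ = ∑ i, (∑ a, c a * L1 a i) * ∑ j, ∑ k, L2 b j * L3 b k * T i j k := by
          rw [Finset.sum_comm]
          refine Finset.sum_congr rfl fun i _ => ?_
          simp only [← Finset.mul_sum, ← Finset.sum_mul]
      _ = 0 := by simp [hc']
  simpa using hli.fintype_card_le_finrank

theorem le_subrank {ι1 ι2 ι3 : Type*} [Fintype ι1] [Fintype ι2] [Fintype ι3]
    {T : ι1 → ι2 → ι3 → F} {r : ℕ} (h : Restricts T (unitTensor F r)) : r ≤ subrank T :=
  le_csSup ⟨Fintype.card ι1, fun _ hs => card_le_of_restricts_unitTensor hs⟩ h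

theorem subrank_le_card {ι1 ι2 ι3 : Type*} [Fintype ι1] [Fintype ι2] [Fintype ι3]
    (T : ι1 → ι2 → ι3 → F) : subrank T ≤ Fintype.card ι1 :=
  csSup_le' fun _ hs => card_le_of_restricts_unitTensor hs

theorem asympSubrank_nonneg {ι1 ι2 ι3 : Type*} [Fintype ι1] [Fintype ι2] [Fintype ι3]
    (T : ι1 → ι2 → ι3 → F) : 0 ≤ asympSubrank T :=
  Real.iSup_nonneg fun _ => by positivity

theorem subrank_kronPow_le_asympSubrank_pow {ι1 ι2 ι3 : Type*} [Fintype ι1] [Fintype ι2]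
    [Fintype ι3] (T : ι1 → ι2 → ι3 → F) {N : ℕ} (hN : 0 < N) :
    (subrank (kronPow T N) : ℝ) ≤ asympSubrank T ^ N := by
  classical
  obtain ⟨m, rfl⟩ := Nat.exists_eq_succ_of_ne_zero hN.ne'
  have hbdd : BddAbove (Set.range fun m : ℕ =>
      (subrank (kronPow T (m + 1)) : ℝ) ^ ((1 : ℝ) / (m + 1))) := by
    refine ⟨Fintype.card ι1, ?_⟩
    rintro _ ⟨k, rfl⟩
    have h : (subrank (kronPow T (k + 1)) : ℝ) ≤ (Fintype.card ι1 : ℝ) ^ (k + 1) := by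
      exact_mod_cast (subrank_le_card _).trans_eq (by simp)
    calc (subrank (kronPow T (k + 1)) : ℝ) ^ ((1 : ℝ) / (k + 1))
        ≤ ((Fintype.card ι1 : ℝ) ^ (k + 1)) ^ ((1 : ℝ) / (k + 1)) :=
          Real.rpow_le_rpow (by positivity) h (by positivity)
      _ = Fintype.card ι1 := by
          have := Real.pow_rpow_inv_natCast (x := (Fintype.card ι1 : ℝ)) (by positivity)
            (Nat.succ_ne_zero k)
          simpa [one_div] using this
  have h := le_ciSup hbdd m
  have h2 := pow_le_pow_left₀ (by positivity) h (m + 1)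
  refine le_trans (le_of_eq ?_) h2
  have := Real.rpow_inv_natCast_pow (x := (subrank (kronPow T (m + 1)) : ℝ)) (by positivity)
    (Nat.succ_ne_zero m)
  simpa [one_div] using this.symm

/-- Product functionals applied to a Kronecker power. -/
theorem restricts_kronPow_prod {ι1 ι2 ι3 κ1 κ2 κ3 : Type*} [Fintype ι1] [Fintype ι2] [Fintype ι3]
    (T : ι1 → ι2 → ι3 → F) {N : ℕ} (L1 : κ1 → Fin N → ι1 → F) (L2 : κ2 → Fin N → ι2 → F)
    (L3 : κ3 → Fin N → ι3 → F) (w : κ1 → F) :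
    Restricts (kronPow T N) fun a b c =>
      w a * ∏ s, ∑ i, ∑ j, ∑ k, L1 a s i * L2 b s j * L3 c s k * T i j k := by
  classical
  refine ⟨fun a x => w a * ∏ s, L1 a s (x s), fun b y => ∏ s, L2 b s (y s),
    fun c z => ∏ s, L3 c s (z s), fun a b c => ?_⟩
  simp only [Finset.prod_univ_sum, Fintype.piFinset_univ, Finset.mul_sum, kronPow,
    Finset.prod_mul_distrib, mul_assoc]

theorem exists_pivots {n : ℕ} (T : Fin n → Fin n → Fin n → F)
    (hT : (flattening3 T).rank = n) :
    ∃ (P : Finset (Fin n × Fin n)) (L : Fin n × Fin n → Fin n → F), n ≤ P.card ∧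
      ∀ p ∈ P, ∑ k, L p k * T p.1 p.2 k ≠ 0 ∧
        ∀ i j : Fin n, ∑ k, L p k * T i j k ≠ 0 → n * p.1.val + p.2.val ≤ n * i.val + j.val := by
  classical
  let W : Submodule F (Fin n × Fin n → F) := Submodule.span F (Set.range (flattening3 T).row)
  let Lead : Fin n × Fin n → (Fin n × Fin n → F) → Prop := fun p f =>
    f p ≠ 0 ∧ ∀ q, f q ≠ 0 → n * p.1.val + p.2.val ≤ n * q.1.val + q.2.val
  let P : Finset (Fin n × Fin n) := Finset.univ.filter fun p => ∃ f ∈ W, Lead p f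
  have hmem : ∀ f ∈ W, ∃ c : Fin n → F, ∀ i j, ∑ k, c k * T i j k = f (i, j) := by
    intro f hf
    obtain ⟨c, rfl⟩ := (Submodule.mem_span_range_iff_exists_fun F).1 hf
    exact ⟨c, fun i j => by simp [flattening3, Matrix.row]⟩
  have hex : ∀ p : Fin n × Fin n, ∃ c : Fin n → F, p ∈ P →
      Lead p (fun q => ∑ k, c k * T q.1 q.2 k) := by
    intro p
    by_cases hp : p ∈ P
    · obtain ⟨f, hf, hl⟩ := (Finset.mem_filter.1 hp).2
      obtain ⟨c, hc⟩ := hmem f hf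
      refine ⟨c, fun _ => ?_⟩
      have : (fun q : Fin n × Fin n => ∑ k, c k * T q.1 q.2 k) = f := by
        ext q; exact hc q.1 q.2
      rwa [this]
    · exact ⟨0, fun h => absurd h hp⟩
  choose L hL using hex
  refine ⟨P, L, ?_, fun p hp => ⟨(hL p hp).1, fun i j h => (hL p hp).2 (i, j) h⟩⟩
  let ev : W →ₗ[F] (P → F) := (LinearMap.funLeft F F (Subtype.val : P → _)) ∘ₗ W.subtype
  have hinj : Function.Injective ev := by
    rw [injective_iff_map_eq_zero]
    intro f hf
    by_contra hne
    obtain ⟨q₀, hq₀⟩ : ∃ q, (f : Fin n × Fin n → F) q ≠ 0 := by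
      by_contra! h
      exact hne (Subtype.ext (funext h))
    obtain ⟨p, hp, hmin⟩ := Finset.exists_min_image
      (Finset.univ.filter fun q => (f : Fin n × Fin n → F) q ≠ 0)
      (fun q => n * q.1.val + q.2.val) ⟨q₀, by simpa using hq₀⟩
    have hp0 : (f : Fin n × Fin n → F) p ≠ 0 := (Finset.mem_filter.1 hp).2
    have hpP : p ∈ P := Finset.mem_filter.2 ⟨Finset.mem_univ _, f, f.2, hp0, fun q hq =>
      hmin q (by simpa using hq)⟩
    exact hp0 (congrFun hf ⟨p, hpP⟩)
  have h := LinearMap.finrank_le_finrank_of_injective hinj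
  have hW : Module.finrank F W = n :=
    (Matrix.rank_eq_finrank_span_row _).symm.trans hT
  simpa [hW] using h

theorem card_filter_fun_eq_zero {U : Type*} [Fintype U] [DecidableEq U] (q : ℕ) (s : Finset U) :
    (Finset.univ.filter fun f : U → Fin (q + 1) => ∀ u ∈ s, f u = 0).card * (q + 1) ^ s.card
      = (q + 1) ^ Fintype.card U := by
  have h : (Finset.univ.filter fun f : U → Fin (q + 1) => ∀ u ∈ s, f u = 0)
      = Fintype.piFinset fun u => if u ∈ s then {0} else Finset.univ := by
    ext f
    simp only [Finset.mem_filter, Finset.mem_univ, true_and, Fintype.mem_piFinset]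
    refine forall_congr' fun u => ?_
    by_cases hu : u ∈ s <;> simp [hu]
  rw [h, Fintype.card_piFinset]
  have h2 : ∀ u, (if u ∈ s then ({0} : Finset (Fin (q + 1))) else Finset.univ).card
      = if u ∈ s then 1 else q + 1 := fun u => by split_ifs <;> simp
  simp only [h2]
  rw [Finset.prod_ite, Finset.prod_const_one, one_mul, Finset.prod_const, ← pow_add]
  congr 1
  rw [show (Finset.univ.filter fun u => u ∉ s) = sᶜ by ext; simp]
  exact Finset.card_compl_add_card s

theorem sum_card_filter_eq_zero {U I : Type*} [Fintype U] [DecidableEq U] (q k : ℕ)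
    (J : Finset I) (S : I → Finset U) (hS : ∀ i ∈ J, (S i).card = k) :
    (∑ f : U → Fin (q + 1), (J.filter fun i => ∀ u ∈ S i, f u = 0).card) * (q + 1) ^ k
      = J.card * (q + 1) ^ Fintype.card U := by
  have h : ∑ f : U → Fin (q + 1), (J.filter fun i => ∀ u ∈ S i, f u = 0).card
      = ∑ i ∈ J, (Finset.univ.filter fun f : U → Fin (q + 1) => ∀ u ∈ S i, f u = 0).card := by
    simp only [Finset.card_filter]
    exact Finset.sum_comm
  rw [h, Finset.sum_mul, Finset.card_eq_sum_ones, Finset.sum_mul]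
  refine Finset.sum_congr rfl fun i hi => ?_
  rw [one_mul, ← hS i hi, card_filter_fun_eq_zero]

/-- A random subset of density `1 / Q`, with `Q = 12 * K * s`, contains few of the given pairs and
triples. -/
theorem exists_sparse_sample {U I₂ I₃ : Type*} [Fintype U] [DecidableEq U] {K s : ℕ} (hK : 0 < K)
    (hs0 : 0 < s) (hs : K ≤ s ^ 2) (J₂ : Finset I₂) (S₂ : I₂ → Finset U) (hS₂ : ∀ i ∈ J₂, (S₂ i).card = 2)
    (J₃ : Finset I₃) (S₃ : I₃ → Finset U) (hS₃ : ∀ i ∈ J₃, (S₃ i).card = 3)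
    (hJ₂ : J₂.card ≤ Fintype.card U * (3 * K)) (hJ₃ : J₃.card ≤ Fintype.card U * (K * (K * K))) :
    ∃ A : Finset U, Fintype.card U + 24 * K * s * ((J₂.filter fun i => S₂ i ⊆ A).card +
      (J₃.filter fun i => S₃ i ⊆ A).card) ≤ 24 * K * s * A.card := by
  obtain ⟨q, hq⟩ : ∃ q, q + 1 = 12 * K * s :=
    ⟨12 * K * s - 1, Nat.sub_add_cancel (show 0 < 12 * K * s by positivity)⟩
  have e : 24 * K * s = 2 * (q + 1) := by rw [hq]; ring
  rw [e]
  let A : (U → Fin (q + 1)) → Finset U := fun f =>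
    Finset.univ.filter fun d => ∀ u ∈ ({d} : Finset U), f u = 0
  let A2 : (U → Fin (q + 1)) → Finset I₂ := fun f => J₂.filter fun i => ∀ u ∈ S₂ i, f u = 0
  let A3 : (U → Fin (q + 1)) → Finset I₃ := fun f => J₃.filter fun i => ∀ u ∈ S₃ i, f u = 0
  have h1 := sum_card_filter_eq_zero q 1 (Finset.univ : Finset U) (fun d => {d})
    (fun _ _ => Finset.card_singleton _)
  have h2 := sum_card_filter_eq_zero q 2 J₂ S₂ hS₂
  have h3 := sum_card_filter_eq_zero q 3 J₃ S₃ hS₃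
  change (∑ f, (A f).card) * _ = _ at h1
  change (∑ f, (A2 f).card) * _ = _ at h2
  change (∑ f, (A3 f).card) * _ = _ at h3
  rw [Finset.card_univ] at h1
  by_contra! hcon
  replace hcon : ∀ f : U → Fin (q + 1), 2 * (q + 1) * (A f).card
      < Fintype.card U + 2 * (q + 1) * ((A2 f).card + (A3 f).card) := fun f => by
    simpa [A, A2, A3, Finset.subset_iff] using hcon (Finset.univ.filter fun u => f u = 0)
  have hlt : ∑ f : U → Fin (q + 1), 2 * (q + 1) * (A f).card
      < ∑ f : U → Fin (q + 1), (Fintype.card U + 2 * (q + 1) * ((A2 f).card + (A3 f).card)) :=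
    Finset.sum_lt_sum_of_nonempty Finset.univ_nonempty fun f _ => hcon f
  rw [← Finset.mul_sum, Finset.sum_add_distrib, ← Finset.mul_sum, Finset.sum_add_distrib,
    Finset.sum_const, Finset.card_univ, Fintype.card_fun, Fintype.card_fin, smul_eq_mul] at hlt
  have hlt' := Nat.mul_lt_mul_of_pos_right hlt (show 0 < (q + 1) ^ 2 by positivity)
  set B := (q + 1) ^ Fintype.card U
  set a := ∑ f, (A f).card
  set b := ∑ f, (A2 f).card
  set c := ∑ f, (A3 f).card
  have e1 : 2 * (q + 1) * a * (q + 1) ^ 2 = 2 * (q + 1) ^ 2 * (Fintype.card U * B) := by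
    rw [← h1]; ring
  have e2 : (B * Fintype.card U + 2 * (q + 1) * (b + c)) * (q + 1) ^ 2
      = (q + 1) ^ 2 * (Fintype.card U * B) + 2 * (q + 1) * (J₂.card * B)
        + 2 * (J₃.card * B) := by
    rw [← h2, ← h3]; ring
  rw [e1, e2] at hlt'
  have b2 : 2 * (q + 1) * (J₂.card * B) ≤ 2 * (q + 1) * (Fintype.card U * (3 * K) * B) := by
    gcongr
  have b3 : 2 * (J₃.card * B) ≤ 2 * (Fintype.card U * (K * (K * K)) * B) := by gcongr
  have c2 : 2 * (2 * (q + 1) * (Fintype.card U * (3 * K) * B))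
      ≤ (q + 1) ^ 2 * (Fintype.card U * B) := by
    calc _ = (q + 1) * (Fintype.card U * B) * (12 * K * 1) := by ring
      _ ≤ (q + 1) * (Fintype.card U * B) * (12 * K * s) := by gcongr; exact hs0
      _ = _ := by rw [← hq]; ring
  have c3 : 2 * (2 * (Fintype.card U * (K * (K * K)) * B))
      ≤ (q + 1) ^ 2 * (Fintype.card U * B) := by
    calc _ = 4 * K ^ 2 * K * (Fintype.card U * B) := by ring
      _ ≤ 144 * K ^ 2 * s ^ 2 * (Fintype.card U * B) := by gcongr; norm_num
      _ = _ := by rw [hq]; ring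
  nlinarith

theorem card_le_card_sdiff_image {U I₂ I₃ : Type*} [DecidableEq U] (A : Finset U) (B₂ : Finset I₂)
    (B₃ : Finset I₃) (f₂ : I₂ → U) (f₃ : I₃ → U) :
    A.card ≤ (A \ (B₂.image f₂ ∪ B₃.image f₃)).card + (B₂.card + B₃.card) :=
  Finset.card_le_card_sdiff_add_card.trans (Nat.add_le_add_left
    ((Finset.card_union_le _ _).trans (add_le_add Finset.card_image_le Finset.card_image_le)) _)

/-- A deletion argument: a set of triples, any two of whose legs determine the triple and whose
legs have fibres of size at most `K`, contains an induced matching of density `K ^ (-3/2)`. -/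
theorem exists_induced_matching {U X Y Z : Type*} [Fintype U] [DecidableEq U] [DecidableEq X]
    [DecidableEq Y] [DecidableEq Z] (x : U → X) (y : U → Y) (z : U → Z)
    (hxy : ∀ u v, x u = x v → y u = y v → u = v) (hyz : ∀ u v, y u = y v → z u = z v → u = v)
    (hxz : ∀ u v, x u = x v → z u = z v → u = v) {K s : ℕ} (hK : 0 < K) (hs : K ≤ s ^ 2)
    (hx : ∀ u, (Finset.univ.filter fun v => x u = x v).card ≤ K)
    (hy : ∀ u, (Finset.univ.filter fun v => y u = y v).card ≤ K)
    (hz : ∀ u, (Finset.univ.filter fun v => z u = z v).card ≤ K) :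
    ∃ D : Finset U, Fintype.card U ≤ D.card * (24 * K * s) ∧
      ∀ v, ∀ d₁ ∈ D, ∀ d₂ ∈ D, ∀ d₃ ∈ D, x v = x d₁ → y v = y d₂ → z v = z d₃ →
        d₁ = d₂ ∧ d₂ = d₃ := by
  have hs0 : 0 < s := by
    rcases Nat.eq_zero_or_pos s with rfl | h
    · simp at hs; omega
    · exact h
  let pairs : Finset (Σ _ : U, U) := Finset.univ.sigma fun d =>
    Finset.univ.filter fun d' => d ≠ d' ∧ (x d = x d' ∨ y d = y d' ∨ z d = z d')
  let triples : Finset (Σ _ : U, U × U × U) := Finset.univ.sigma fun v =>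
    ((Finset.univ.filter fun d => x v = x d) ×ˢ (Finset.univ.filter fun d => y v = y d) ×ˢ
      (Finset.univ.filter fun d => z v = z d)).filter fun t =>
        t.1 ≠ t.2.1 ∧ t.1 ≠ t.2.2 ∧ t.2.1 ≠ t.2.2
  have hpairs : pairs.card ≤ Fintype.card U * (3 * K) := by
    rw [Finset.card_sigma, ← Finset.card_univ, ← smul_eq_mul]
    refine Finset.sum_le_card_nsmul _ _ _ fun d _ => ?_
    calc _ ≤ ((Finset.univ.filter fun v => x d = x v) ∪ ((Finset.univ.filter fun v => y d = y v) ∪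
            (Finset.univ.filter fun v => z d = z v))).card := by
          refine Finset.card_le_card fun v => ?_
          simp only [Finset.mem_filter, Finset.mem_union, Finset.mem_univ, true_and]
          exact fun h => h.2
      _ ≤ K + (K + K) := (Finset.card_union_le _ _).trans
          (add_le_add (hx d) ((Finset.card_union_le _ _).trans (add_le_add (hy d) (hz d))))
      _ = 3 * K := by ring
  have htriples : triples.card ≤ Fintype.card U * (K * (K * K)) := by
    rw [Finset.card_sigma, ← Finset.card_univ, ← smul_eq_mul]
    refine Finset.sum_le_card_nsmul _ _ _ fun v _ => ?_
    refine (Finset.card_filter_le _ _).trans ?_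
    rw [Finset.card_product, Finset.card_product]
    exact Nat.mul_le_mul (hx v) (Nat.mul_le_mul (hy v) (hz v))
  obtain ⟨A, hA⟩ := exists_sparse_sample hK hs0 hs pairs (fun p => {p.1, p.2}) (fun p hp => by
    simp only [pairs, Finset.mem_sigma, Finset.mem_filter] at hp
    exact Finset.card_pair hp.2.2.1) triples (fun t => {t.2.1, t.2.2.1, t.2.2.2}) (fun t ht => by
      simp only [triples, Finset.mem_sigma, Finset.mem_filter] at ht
      exact Finset.card_eq_three.2 ⟨_, _, _, ht.2.2.1, ht.2.2.2.1, ht.2.2.2.2, rfl⟩) hpairs htriples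
  set A2 := pairs.filter fun p => ({p.1, p.2} : Finset U) ⊆ A with hA2
  set A3 := triples.filter fun t => ({t.2.1, t.2.2.1, t.2.2.2} : Finset U) ⊆ A with hA3
  refine ⟨A \ (A2.image (fun p => p.1) ∪ A3.image (fun t => t.2.1)), ?_, ?_⟩
  · have hle := card_le_card_sdiff_image A A2 A3 (fun p => p.1) (fun t => t.2.1)
    have := Nat.mul_le_mul_left (24 * K * s) hle
    linarith
  · intro v d₁ hd₁ d₂ hd₂ d₃ hd₃ hvx hvy hvz
    have hpair : ∀ d d', d ∈ A \ (A2.image (fun p => p.1) ∪ A3.image (fun t => t.2.1)) →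
        d' ∈ A → (x d = x d' ∨ y d = y d' ∨ z d = z d') → d = d' := by
      intro d d' hd hd' h
      by_contra hne
      simp only [Finset.mem_sdiff, Finset.mem_union, not_or] at hd
      refine hd.2.1 (Finset.mem_image.2 ⟨⟨d, d'⟩, ?_, rfl⟩)
      simp [hA2, pairs, Finset.insert_subset_iff, hne, h, hd.1, hd']
    have hz₁ : d₁ ∈ A := (Finset.mem_sdiff.1 hd₁).1
    have hz₂ : d₂ ∈ A := (Finset.mem_sdiff.1 hd₂).1
    have hz₃ : d₃ ∈ A := (Finset.mem_sdiff.1 hd₃).1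
    by_cases h12 : d₁ = d₂
    · subst h12
      obtain rfl := hxy v d₁ hvx hvy
      exact ⟨rfl, hpair _ _ hd₁ hz₃ (by simp [hvz])⟩
    by_cases h23 : d₂ = d₃
    · subst h23
      obtain rfl := hyz v d₂ hvy hvz
      exact ⟨(hpair _ _ hd₂ hz₁ (by simp [hvx])).symm, rfl⟩
    by_cases h13 : d₁ = d₃
    · subst h13
      obtain rfl := hxz v d₁ hvx hvz
      exact absurd (hpair _ _ hd₁ hz₂ (by simp [hvy])) h12
    exfalso
    simp only [Finset.mem_sdiff, Finset.mem_union, not_or] at hd₁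
    refine hd₁.2.2 (Finset.mem_image.2 ⟨⟨v, d₁, d₂, d₃⟩, ?_, rfl⟩)
    simp [hA3, triples, Finset.insert_subset_iff, hvx.symm, hvy.symm, hvz.symm, h12, h13, h23, hz₁, hz₂, hz₃]

theorem card_image_mul_le_card {G I : Type*} [Fintype G] [DecidableEq I] (C : Finset G) (α : G → I)
    {a : ℕ} (ha : ∀ e ∈ C, (Finset.univ.filter fun e' => α e' = α e).card = a) :
    (C.image α).card * a ≤ Fintype.card G := by
  classical
  calc (C.image α).card * a
      = ∑ i ∈ C.image α, (Finset.univ.filter fun e' => α e' = i).card := by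
        rw [← smul_eq_mul, ← Finset.sum_const]
        refine Finset.sum_congr rfl fun i hi => ?_
        obtain ⟨e, he, rfl⟩ := Finset.mem_image.1 hi
        exact (ha e he).symm
    _ = ((C.image α).biUnion fun i => Finset.univ.filter fun e' => α e' = i).card := by
        refine (Finset.card_biUnion fun i _ j _ hij => ?_).symm
        exact Finset.disjoint_filter.2 fun e _ h1 h2 => hij (h1.symm.trans h2)
    _ ≤ Fintype.card G := Finset.card_le_univ _

/-- Degrees in a bipartite graph with edge set `G`, on edges `C` with constant left and right
degree. -/
theorem mul_mul_card_le {G I J : Type*} [Fintype G] [DecidableEq I] [DecidableEq J] (C : Finset G)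
    (α : G → I) (β : G → J) (hinj : ∀ e e', α e = α e' → β e = β e' → e = e') {a b : ℕ}
    (ha : ∀ e ∈ C, (Finset.univ.filter fun e' => α e' = α e).card = a)
    (hb : ∀ e ∈ C, (Finset.univ.filter fun e' => β e' = β e).card = b) :
    a * b * C.card ≤ Fintype.card G ^ 2 := by
  have h : C.card ≤ (C.image α).card * (C.image β).card := by
    rw [← Finset.card_product]
    refine Finset.card_le_card_of_injOn (fun e => (α e, β e)) (fun e he => ?_)
      fun e _ e' _ h => hinj e e' (congrArg Prod.fst h) (congrArg Prod.snd h)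
    exact Finset.mem_product.2 ⟨Finset.mem_image_of_mem _ he, Finset.mem_image_of_mem _ he⟩
  calc a * b * C.card ≤ a * b * ((C.image α).card * (C.image β).card) := Nat.mul_le_mul_left _ h
    _ = ((C.image α).card * a) * ((C.image β).card * b) := by ring
    _ ≤ Fintype.card G * Fintype.card G :=
        Nat.mul_le_mul (card_image_mul_le_card C α ha) (card_image_mul_le_card C β hb)
    _ = _ := by ring

theorem card_filter_prod_prod_le {A B C : Type*} [Fintype A] [Fintype B] [Fintype C] (p : A → Prop)
    (q : B → Prop) (r : C → Prop) [DecidablePred p] [DecidablePred q] [DecidablePred r] {a b c : ℕ}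
    (hp : (Finset.univ.filter p).card ≤ a) (hq : (Finset.univ.filter q).card ≤ b)
    (hr : (Finset.univ.filter r).card ≤ c) :
    (Finset.univ.filter fun u : A × B × C => p u.1 ∧ q u.2.1 ∧ r u.2.2).card ≤ a * (b * c) := by
  have h : (Finset.univ.filter fun u : A × B × C => p u.1 ∧ q u.2.1 ∧ r u.2.2)
      = Finset.univ.filter p ×ˢ Finset.univ.filter q ×ˢ Finset.univ.filter r := by
    ext; simp
  rw [h, Finset.card_product, Finset.card_product]
  exact Nat.mul_le_mul hp (Nat.mul_le_mul hq hr)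

/-- An induced matching in the support of the product of the three cyclic shifts of a bipartite
graph tensor. -/
theorem exists_induced_matching_edges {G I J : Type*} [Fintype G] [DecidableEq G] [DecidableEq I]
    [DecidableEq J] (C : Finset G) (α : G → I) (β : G → J)
    (hinj : ∀ e e', α e = α e' → β e = β e' → e = e') {a b s : ℕ} (hab : 0 < a * b)
    (ha : ∀ e ∈ C, (Finset.univ.filter fun e' => α e' = α e).card = a)
    (hb : ∀ e ∈ C, (Finset.univ.filter fun e' => β e' = β e).card = b) (hs : a * b ≤ s ^ 2) :
    ∃ D : Finset (C × C × C), C.card ^ 3 ≤ D.card * (24 * (a * b) * s) ∧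
      ∀ v : C × C × C, ∀ d₁ ∈ D, ∀ d₂ ∈ D, ∀ d₃ ∈ D,
        (α v.1 = α d₁.1 ∧ β v.2.1 = β d₁.2.1 ∧ v.2.2 = d₁.2.2) →
        (β v.1 = β d₂.1 ∧ v.2.1 = d₂.2.1 ∧ α v.2.2 = α d₂.2.2) →
        (v.1 = d₃.1 ∧ α v.2.1 = α d₃.2.1 ∧ β v.2.2 = β d₃.2.2) → d₁ = d₂ ∧ d₂ = d₃ := by
  have hinj' : ∀ e e' : C, α e = α e' → β e = β e' → e = e' := fun e e' h1 h2 =>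
    Subtype.ext (hinj _ _ h1 h2)
  have hα : ∀ u : C, (Finset.univ.filter fun v : C => α u = α v).card ≤ a := fun u => by
    rw [← ha u u.2]
    exact Finset.card_le_card_of_injOn Subtype.val (fun v hv => by simpa [eq_comm] using hv)
      Subtype.val_injective.injOn
  have hβ : ∀ u : C, (Finset.univ.filter fun v : C => β u = β v).card ≤ b := fun u => by
    rw [← hb u u.2]
    exact Finset.card_le_card_of_injOn Subtype.val (fun v hv => by simpa [eq_comm] using hv)
      Subtype.val_injective.injOn
  have hone : ∀ u : C, (Finset.univ.filter fun v : C => u = v).card ≤ 1 := fun u => by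
    simp [Finset.filter_eq]
  obtain ⟨D, hD, hd⟩ := exists_induced_matching (U := C × C × C)
    (fun u => (α u.1, β u.2.1, u.2.2)) (fun u => (β u.1, u.2.1, α u.2.2))
    (fun u => (u.1, α u.2.1, β u.2.2))
    (by
      rintro ⟨u₁, u₂, u₃⟩ ⟨v₁, v₂, v₃⟩ h1 h2
      simp only [Prod.mk.injEq] at h1 h2 ⊢
      exact ⟨hinj' _ _ h1.1 h2.1, h2.2.1, h1.2.2⟩)
    (by
      rintro ⟨u₁, u₂, u₃⟩ ⟨v₁, v₂, v₃⟩ h1 h2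
      simp only [Prod.mk.injEq] at h1 h2 ⊢
      exact ⟨h2.1, h1.2.1, hinj' _ _ h1.2.2 h2.2.2⟩)
    (by
      rintro ⟨u₁, u₂, u₃⟩ ⟨v₁, v₂, v₃⟩ h1 h2
      simp only [Prod.mk.injEq] at h1 h2 ⊢
      exact ⟨h2.1, hinj' _ _ h2.2.1 h1.2.1, h1.2.2⟩)
    hab hs
    (fun u => by
      simpa using card_filter_prod_prod_le (fun e : C => α u.1 = α e) (fun e : C => β u.2.1 = β e)
        (fun e : C => u.2.2 = e) (hα u.1) (hβ u.2.1) (hone u.2.2))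
    (fun u => by
      simpa [mul_comm b a] using card_filter_prod_prod_le (fun e : C => β u.1 = β e)
        (fun e : C => u.2.1 = e) (fun e : C => α u.2.2 = α e) (hβ u.1) (hone u.2.1) (hα u.2.2))
    (fun u => by
      simpa using card_filter_prod_prod_le (fun e : C => u.1 = e) (fun e : C => α u.2.1 = α e)
        (fun e : C => β u.2.2 = β e) (hone u.1) (hα u.2.1) (hβ u.2.2))
  refine ⟨D, ?_, fun v d₁ h₁ d₂ h₂ d₃ h₃ hx hy hz => hd v d₁ h₁ d₂ h₂ d₃ h₃ ?_ ?_ ?_⟩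
  · refine le_trans (le_of_eq ?_) hD
    simp [pow_three]
  · simpa using hx
  · simpa using hy
  · simpa using hz

/-- A largest type class of sequences of length `m` over `E`. -/
theorem exists_type_class (E : Type*) [Fintype E] [DecidableEq E] (m : ℕ) :
    ∃ C : Finset (Fin m → E), Fintype.card E ^ m ≤ C.card * (m + 1) ^ Fintype.card E ∧
      ∀ e ∈ C, ∀ e' ∈ C, ∃ σ : Equiv.Perm (Fin m), ∀ s, e' (σ s) = e s := by
  let τ : (Fin m → E) → E → Fin (m + 1) := fun e x =>
    ⟨Fintype.card {s // e s = x}, Nat.lt_succ_of_le ((Fintype.card_subtype_le _).trans_eq (by simp))⟩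
  obtain ⟨t, ht⟩ := Finite.exists_max fun t : E → Fin (m + 1) =>
    (Finset.univ.filter fun e => τ e = t).card
  refine ⟨Finset.univ.filter fun e => τ e = t, ?_, fun e he e' he' => ?_⟩
  · have h := Finset.card_eq_sum_card_fiberwise (f := τ) (s := Finset.univ) (t := Finset.univ)
      fun _ _ => Finset.mem_univ _
    have h2 := h.trans_le (Finset.sum_le_card_nsmul _ _ _ fun t _ => ht t)
    simpa [mul_comm] using h2
  · have hτ : τ e = τ e' := by
      rw [(Finset.mem_filter.1 he).2, (Finset.mem_filter.1 he').2]
    have hc : ∀ x, Fintype.card {s // e s = x} = Fintype.card {s // e' s = x} := fun x =>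
      congrArg Fin.val (congrFun hτ x)
    exact ⟨Equiv.ofFiberEquiv fun x => Fintype.equivOfCardEq (hc x),
      fun s => Equiv.ofFiberEquiv_map _ s⟩

theorem card_filter_comp_eq {E I : Type*} [Fintype E] [DecidableEq I] {m : ℕ} (α : E → I)
    (e : Fin m → E) :
    (Finset.univ.filter fun e' : Fin m → E => α ∘ e' = α ∘ e).card
      = ∏ s, (Finset.univ.filter fun x => α x = α (e s)).card := by
  classical
  rw [← Fintype.card_piFinset]
  congr 1
  ext e'
  simp [funext_iff, Fintype.mem_piFinset]

theorem restricts_kronPow_cyclic {ι E R : Type*} [Fintype ι] [DecidableEq ι]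
    (T : ι → ι → ι → F) (hsym12 : ∀ i j k, T i j k = T j i k)
    (hsym23 : ∀ i j k, T i j k = T i k j) (L : E → ι → F) (α β : E → ι) {m : ℕ}
    (e₁ e₂ e₃ : R → Fin m → E) (w : R → F) :
    Restricts (kronPow T (3 * m)) fun a b c =>
      w a * ((∏ s, ∑ k, L (e₁ c s) k * T (α (e₁ a s)) (β (e₁ b s)) k) *
        (∏ s, ∑ k, L (e₂ b s) k * T (α (e₂ c s)) (β (e₂ a s)) k) *
        (∏ s, ∑ k, L (e₃ a s) k * T (α (e₃ b s)) (β (e₃ c s)) k)) := by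
  let g : Fin (3 * m) ≃ Fin 3 × Fin m := finProdFinEquiv.symm
  have h := restricts_kronPow_prod T
    (fun a t => ![Pi.single (α (e₁ a (g t).2)) 1, Pi.single (β (e₂ a (g t).2)) 1,
      L (e₃ a (g t).2)] (g t).1)
    (fun a t => ![Pi.single (β (e₁ a (g t).2)) 1, L (e₂ a (g t).2),
      Pi.single (α (e₃ a (g t).2)) 1] (g t).1)
    (fun a t => ![L (e₁ a (g t).2), Pi.single (α (e₂ a (g t).2)) 1,
      Pi.single (β (e₃ a (g t).2)) 1] (g t).1) w
  convert h using 4 with a b c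
  rw [Equiv.prod_comp g (fun p : Fin 3 × Fin m => ∑ i, ∑ j, ∑ k,
    ![Pi.single (α (e₁ a p.2)) 1, Pi.single (β (e₂ a p.2)) 1, L (e₃ a p.2)] p.1 i *
    ![Pi.single (β (e₁ b p.2)) 1, L (e₂ b p.2), Pi.single (α (e₃ b p.2)) 1] p.1 j *
    ![L (e₁ c p.2), Pi.single (α (e₂ c p.2)) 1, Pi.single (β (e₃ c p.2)) 1] p.1 k * T i j k),
    Fintype.prod_prod_type, Fin.prod_univ_three]
  refine congrArg (w a * ·) (congrArg₂ (· * ·) (congrArg₂ (· * ·) (Finset.prod_congr rfl fun s _ => ?_)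
    (Finset.prod_congr rfl fun s _ => ?_)) (Finset.prod_congr rfl fun s _ => ?_))
  · simp [Pi.single_apply]
  · simp only [Matrix.cons_val_one, Matrix.cons_val_zero, Pi.single_apply]
    simp
    refine Finset.sum_congr rfl fun k _ => ?_
    rw [hsym12 (α _), hsym23 (β _)]
  · simp [Pi.single_apply]
    refine Finset.sum_congr rfl fun k _ => ?_
    rw [hsym12 k, hsym23 (α _) k]

theorem eq_of_mul_add_eq {n : ℕ} {i i' j j' : Fin n}
    (h : n * i.val + j.val = n * i'.val + j'.val) : i = i' ∧ j = j' := by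
  have h1 := congrArg (· / n) h
  have h2 := congrArg (· % n) h
  have hn : 0 < n := i.pos
  simp only [Nat.mul_add_div hn, Nat.div_eq_of_lt j.2, Nat.div_eq_of_lt j'.2, add_zero,
    Nat.mul_add_mod, Nat.mod_eq_of_lt j.2, Nat.mod_eq_of_lt j'.2] at h1 h2
  exact ⟨Fin.ext h1, Fin.ext h2⟩

/-- Sequences of pivots of the same type: only pivots contribute. -/
theorem comp_eq_of_prod_ne_zero {n m : ℕ} {E : Type*} (α β : E → Fin n)
    (S : Fin n → Fin n → E → F)
    (hS : ∀ i j p, S i j p ≠ 0 → n * (α p).val + (β p).val ≤ n * i.val + j.val)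
    (C : Finset (Fin m → E))
    (hC : ∀ e ∈ C, ∀ e' ∈ C, ∃ σ : Equiv.Perm (Fin m), ∀ s, e' (σ s) = e s)
    {e e' e'' : Fin m → E} (he : e ∈ C) (he' : e' ∈ C) (he'' : e'' ∈ C)
    (h : ∏ s, S (α (e s)) (β (e' s)) (e'' s) ≠ 0) : α ∘ e'' = α ∘ e ∧ β ∘ e'' = β ∘ e' := by
  have hle : ∀ s ∈ Finset.univ, n * (α (e'' s)).val + (β (e'' s)).val
      ≤ n * (α (e s)).val + (β (e' s)).val := fun s hs =>
    hS _ _ _ (Finset.prod_ne_zero_iff.1 h s hs)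
  have hsum : ∑ s, (n * (α (e'' s)).val + (β (e'' s)).val)
      = ∑ s, (n * (α (e s)).val + (β (e' s)).val) := by
    obtain ⟨σ, hσ⟩ := hC e he e'' he''
    obtain ⟨σ', hσ'⟩ := hC e' he' e'' he''
    rw [Finset.sum_add_distrib, Finset.sum_add_distrib]
    simp only [← hσ, ← hσ']
    rw [Equiv.sum_comp σ fun s => n * (α (e'' s)).val, Equiv.sum_comp σ' fun s => (β (e'' s)).val]
  have heq := (Finset.sum_eq_sum_iff_of_le hle).1 hsum
  exact ⟨funext fun s => (eq_of_mul_add_eq (heq s (Finset.mem_univ s))).1,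
    funext fun s => (eq_of_mul_add_eq (heq s (Finset.mem_univ s))).2⟩

theorem exists_restricts_kronPow {n : ℕ} (T : Fin n → Fin n → Fin n → F)
    (hsym12 : ∀ i j k, T i j k = T j i k) (hsym23 : ∀ i j k, T i j k = T i k j)
    (hT : (flattening3 T).rank = n) (hn : 0 < n) :
    ∃ c : ℕ, ∀ m : ℕ, ∃ r : ℕ, Restricts (kronPow T (3 * m)) (unitTensor F r) ∧
      n ^ (3 * m) ≤ 2304 * (m + 1) ^ (9 * c) * r ^ 2 := by
  obtain ⟨P, L, hPn, hP⟩ := exists_pivots T hT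
  refine ⟨P.card, fun m => ?_⟩
  let α : P → Fin n := fun p => p.1.1
  let β : P → Fin n := fun p => p.1.2
  let S : Fin n → Fin n → P → F := fun i j p => ∑ k, L p k * T i j k
  have hS : ∀ i j p, S i j p ≠ 0 → n * (α p).val + (β p).val ≤ n * i.val + j.val :=
    fun i j p => (hP p p.2).2 i j
  obtain ⟨C, hCcard, hC⟩ := exists_type_class P m
  rw [Fintype.card_coe] at hCcard
  have hP0 : 0 < P.card := hn.trans_le hPn
  have hCpos : 0 < C.card := by
    refine Nat.pos_of_ne_zero fun h => ?_
    rw [h, zero_mul] at hCcard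
    exact absurd (Nat.pow_pos hP0) hCcard.not_gt
  obtain ⟨e₀, he₀⟩ := Finset.card_pos.1 hCpos
  have hconst : ∀ γ : P → Fin n, ∀ e ∈ C,
      (Finset.univ.filter fun e' : Fin m → P => γ ∘ e' = γ ∘ e).card
        = (Finset.univ.filter fun e' : Fin m → P => γ ∘ e' = γ ∘ e₀).card := by
    intro γ e he
    obtain ⟨σ, hσ⟩ := hC e he e₀ he₀
    rw [card_filter_comp_eq, card_filter_comp_eq]
    simp only [← hσ]
    exact Equiv.prod_comp σ fun s => (Finset.univ.filter fun x => γ x = γ (e₀ s)).card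
  have hpos : ∀ γ : P → Fin n,
      0 < (Finset.univ.filter fun e' : Fin m → P => γ ∘ e' = γ ∘ e₀).card := fun γ =>
    Finset.card_pos.2 ⟨e₀, by simp⟩
  have ha := hconst α
  have hb := hconst β
  have ha0 := hpos α
  have hb0 := hpos β
  set a := (Finset.univ.filter fun e' : Fin m → P => α ∘ e' = α ∘ e₀).card
  set b := (Finset.univ.filter fun e' : Fin m → P => β ∘ e' = β ∘ e₀).card
  have hinj : ∀ e e' : Fin m → P, α ∘ e = α ∘ e' → β ∘ e = β ∘ e' → e = e' :=
    fun e e' h1 h2 => funext fun s => Subtype.ext (Prod.ext (congrFun h1 s) (congrFun h2 s))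
  have hab : 0 < a * b := Nat.mul_pos ha0 hb0
  have hdeg := mul_mul_card_le C (α ∘ ·) (β ∘ ·) hinj ha hb
  obtain ⟨D, hDcard, hD⟩ := exists_induced_matching_edges C (α ∘ ·) (β ∘ ·) hinj hab ha hb
    (s := Nat.sqrt (a * b) + 1) (Nat.lt_succ_sqrt' (a * b)).le
  refine ⟨D.card, ?_, ?_⟩
  · let d : Fin D.card → C × C × C := fun t => (D.equivFin.symm t).1
    have hdD : ∀ t, d t ∈ D := fun t => (D.equivFin.symm t).2
    have hdinj : ∀ t t', d t = d t' → t = t' := fun t t' h =>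
      D.equivFin.symm.injective (Subtype.ext h)
    have h := restricts_kronPow_cyclic T hsym12 hsym23 (fun p : P => L p) α β (m := m)
      (fun t => ((d t).1 : Fin m → P)) (fun t => ((d t).2.1 : Fin m → P))
      (fun t => ((d t).2.2 : Fin m → P))
      (fun t => ((∏ s, S (α ((d t).1.1 s)) (β ((d t).1.1 s)) ((d t).1.1 s)) *
        (∏ s, S (α ((d t).2.1.1 s)) (β ((d t).2.1.1 s)) ((d t).2.1.1 s)) *
        (∏ s, S (α ((d t).2.2.1 s)) (β ((d t).2.2.1 s)) ((d t).2.2.1 s)))⁻¹)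
    convert h using 1
    funext t₁ t₂ t₃
    by_cases ht : t₁ = t₂ ∧ t₂ = t₃
    · obtain ⟨rfl, rfl⟩ := ht
      have hne : ∀ e : Fin m → P, ∏ s, S (α (e s)) (β (e s)) (e s) ≠ 0 := fun e =>
        Finset.prod_ne_zero_iff.2 fun s _ => (hP (e s) (e s).2).1
      rw [unitTensor, if_pos ⟨rfl, rfl⟩]
      exact (inv_mul_cancel₀ (mul_ne_zero (mul_ne_zero (hne _) (hne _)) (hne _))).symm
    · rw [unitTensor, if_neg ht]
      by_contra hne
      have hne' := right_ne_zero_of_mul (Ne.symm hne)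
      have h₁ := comp_eq_of_prod_ne_zero α β S hS C hC (d t₁).1.2 (d t₂).1.2 (d t₃).1.2
        (left_ne_zero_of_mul (left_ne_zero_of_mul hne'))
      have h₂ := comp_eq_of_prod_ne_zero α β S hS C hC (d t₃).2.1.2 (d t₁).2.1.2 (d t₂).2.1.2
        (right_ne_zero_of_mul (left_ne_zero_of_mul hne'))
      have h₃ := comp_eq_of_prod_ne_zero α β S hS C hC (d t₂).2.2.2 (d t₃).2.2.2 (d t₁).2.2.2
        (right_ne_zero_of_mul hne')
      have heq := hD ((d t₃).1, (d t₂).2.1, (d t₁).2.2) _ (hdD t₁) _ (hdD t₂) _ (hdD t₃)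
        ⟨h₁.1, h₂.2, rfl⟩ ⟨h₁.2, rfl, h₃.1⟩ ⟨rfl, h₂.1, h₃.2⟩
      exact ht ⟨hdinj _ _ heq.1, hdinj _ _ heq.2⟩
  · rw [Fintype.card_fun, Fintype.card_coe, Fintype.card_fin] at hdeg
    have hs : (Nat.sqrt (a * b) + 1) ^ 2 ≤ 4 * (a * b) := by
      have h1 : 1 ≤ Nat.sqrt (a * b) := Nat.sqrt_pos.2 hab
      calc (Nat.sqrt (a * b) + 1) ^ 2 ≤ (Nat.sqrt (a * b) + Nat.sqrt (a * b)) ^ 2 := by gcongr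
        _ = 4 * (Nat.sqrt (a * b)) ^ 2 := by ring
        _ ≤ 4 * (a * b) := by gcongr; exact Nat.sqrt_le' _
    set K := a * b
    set s := Nat.sqrt K + 1
    set M := C.card
    set r := D.card
    set N := P.card ^ m with hN
    set W := (m + 1) ^ P.card with hW
    have h6 : M ^ 6 ≤ 2304 * r ^ 2 * K ^ 3 := by
      calc M ^ 6 = (M ^ 3) ^ 2 := by ring
        _ ≤ (r * (24 * K * s)) ^ 2 := by gcongr
        _ = 576 * r ^ 2 * K ^ 2 * s ^ 2 := by ring
        _ ≤ 576 * r ^ 2 * K ^ 2 * (4 * K) := by gcongr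
        _ = _ := by ring
    have h9 : M ^ 9 ≤ 2304 * r ^ 2 * N ^ 6 := by
      calc M ^ 9 = M ^ 6 * M ^ 3 := by ring
        _ ≤ 2304 * r ^ 2 * K ^ 3 * M ^ 3 := by gcongr
        _ = 2304 * r ^ 2 * (K * M) ^ 3 := by ring
        _ ≤ 2304 * r ^ 2 * (N ^ 2) ^ 3 := by gcongr
        _ = _ := by ring
    have hN0 : 0 < N ^ 6 := by positivity
    have h : N ^ 3 ≤ 2304 * W ^ 9 * r ^ 2 := by
      refine Nat.le_of_mul_le_mul_right ?_ hN0
      calc N ^ 3 * N ^ 6 = N ^ 9 := by ring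
        _ ≤ (M * W) ^ 9 := by gcongr
        _ = M ^ 9 * W ^ 9 := by ring
        _ ≤ 2304 * r ^ 2 * N ^ 6 * W ^ 9 := by gcongr
        _ = _ := by ring
    calc n ^ (3 * m) ≤ P.card ^ (3 * m) := by gcongr
      _ = N ^ 3 := by rw [hN, ← pow_mul, mul_comm]
      _ ≤ _ := h
      _ = _ := by rw [hW, ← pow_mul, mul_comm P.card]

theorem one_le_of_forall_le_mul_pow {A x : ℝ} {c : ℕ} (hx : 0 ≤ x)
    (h : ∀ m : ℕ, 0 < m → 1 ≤ A * ((m : ℝ) + 1) ^ c * x ^ m) : 1 ≤ x := by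
  by_contra! hlt
  have ht := tendsto_pow_const_mul_const_pow_of_abs_lt_one c
    (show |x| < 1 by rwa [abs_of_nonneg hx])
  have ht2 := (ht.const_mul (A * 2 ^ c))
  rw [mul_zero] at ht2
  obtain ⟨m, hm, hm0⟩ := ((ht2.eventually_lt_const one_pos).and
    (Filter.eventually_gt_atTop 0)).exists
  have hm1 : (1 : ℝ) ≤ m := by exact_mod_cast hm0
  have h1 := h m hm0
  have hA : 0 < A := by
    by_contra! hA
    have : A * (((m : ℝ) + 1) ^ c * x ^ m) ≤ 0 :=
      mul_nonpos_of_nonpos_of_nonneg hA (by positivity)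
    linarith [mul_assoc A (((m : ℝ) + 1) ^ c) (x ^ m)]
  have h2 : A * ((m : ℝ) + 1) ^ c * x ^ m ≤ A * 2 ^ c * ((m : ℝ) ^ c * x ^ m) := by
    calc A * ((m : ℝ) + 1) ^ c * x ^ m ≤ A * (2 * m) ^ c * x ^ m := by gcongr; linarith
      _ = _ := by rw [mul_pow]; ring
  linarith

/-- Every concise symmetric tensor `T` of format `(n, n, n)` over any
field has asymptotic subrank at least `n^(1/2)`. (Symmetry is invariance of the
coefficients under the two adjacent transpositions, which generate `S_3`.) -/
theorem asympSubrank_ge_sqrt_of_symmetric (F : Type*) [Field F] (n : ℕ)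
    (T : Fin n → Fin n → Fin n → F) (hT : Concise T)
    (hsym12 : ∀ i j k, T i j k = T j i k)
    (hsym23 : ∀ i j k, T i j k = T i k j) :
    ((n : ℝ)) ^ ((1 : ℝ) / 2) ≤ asympSubrank T := by
  have hq := asympSubrank_nonneg T
  rcases Nat.eq_zero_or_pos n with rfl | hn
  · simpa using hq
  have hrank : (flattening3 T).rank = n := by simpa using hT.2.2
  obtain ⟨c, hc⟩ := exists_restricts_kronPow T hsym12 hsym23 hrank hn
  have hn' : (0 : ℝ) < n := by exact_mod_cast hn
  have hx : 1 ≤ (asympSubrank T ^ 2 / n) ^ 3 := by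
    refine one_le_of_forall_le_mul_pow (A := 2304) (c := 9 * c) (by positivity) fun m hm => ?_
    obtain ⟨r, hr, hle⟩ := hc m
    have h1 : (r : ℝ) ≤ asympSubrank T ^ (3 * m) :=
      le_trans (by exact_mod_cast le_subrank hr)
        (subrank_kronPow_le_asympSubrank_pow T (N := 3 * m) (by positivity))
    have h2 : (n : ℝ) ^ (3 * m) ≤ 2304 * ((m : ℝ) + 1) ^ (9 * c) * (r : ℝ) ^ 2 := by
      exact_mod_cast hle
    have h3 : (n : ℝ) ^ (3 * m)
        ≤ 2304 * ((m : ℝ) + 1) ^ (9 * c) * (asympSubrank T ^ (3 * m)) ^ 2 :=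
      h2.trans (by gcongr)
    have e : 2304 * ((m : ℝ) + 1) ^ (9 * c) * ((asympSubrank T ^ 2 / n) ^ 3) ^ m
        = 2304 * ((m : ℝ) + 1) ^ (9 * c) * (asympSubrank T ^ (3 * m)) ^ 2 / (n : ℝ) ^ (3 * m) := by
      rw [← pow_mul, div_pow, ← pow_mul, ← pow_mul, mul_div_assoc, mul_comm (3 * m) 2]
    rw [e, le_div_iff₀ (by positivity), one_mul]
    exact h3
  have hx' : 1 ≤ asympSubrank T ^ 2 / n := by
    by_contra! hlt
    exact absurd hx (pow_lt_one₀ (by positivity) hlt (by norm_num)).not_ge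
  rw [le_div_iff₀ hn', one_mul] at hx'
  rw [← Real.sqrt_eq_rpow]
  exact Real.sqrt_le_iff.2 ⟨hq, hx'⟩


end Paper
end

section
/- Let F be any field. For every integer c ≥ 2 there exists N(c) ∈ ℕ such that for all n1, n2 ∈ ℕ with max{n1, n2} > N(c), every concise tensor T ∈ F^{n1} ⊗ F^{n2} ⊗ F^{c} satisfies Q~(T) = c. -/
open scoped BigOperators

namespace Paper

variable {F : Type*} [Field F]

section TrilinearForms

open Module

variable {V₁ V₂ W : Type*} [AddCommGroup V₁] [Module F V₁] [AddCommGroup V₂] [Module F V₂]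
  [AddCommGroup W] [Module F W]

/-- Vectors on which a trilinear form is block diagonal in its first two arguments. The blocks
indexed by `G × I` are rank one, and the block indexed by `J` is only controlled on its diagonal;
`z g` is dual to the diagonal functionals of the letters `I ⊕ J`, up to triangularity. -/
structure BlockFamily (τ : V₁ →ₗ[F] V₂ →ₗ[F] W →ₗ[F] F) (G I J : Type*) [DecidableEq I]
    [DecidableEq J] where
  x : G → I ⊕ J → V₁
  y : G → I ⊕ J → V₂
  z : G → I ⊕ J → W
  inl_inr : ∀ g g' i j, τ (x g (.inl i)) (y g' (.inr j)) = 0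
  inr_inl : ∀ g g' i j, τ (x g (.inr j)) (y g' (.inl i)) = 0
  inl_inl : ∀ g g' i i', (g, i) ≠ (g', i') → τ (x g (.inl i)) (y g' (.inl i')) = 0
  inl_inl_inr : ∀ g g' i j, τ (x g (.inl i)) (y g (.inl i)) (z g' (.inr j)) = 0
  inl_diag : ∀ g i i', τ (x g (.inl i)) (y g (.inl i)) (z g (.inl i')) = if i = i' then 1 else 0
  inr_diag : ∀ g g' g'' j j',
    τ (x g (.inr j)) (y g' (.inr j)) (z g'' (.inr j')) = if j = j' then 1 else 0

theorem finrank_le_finrank_inf_ker_add {V U : Type*} [AddCommGroup V] [Module F V]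
    [FiniteDimensional F V] [AddCommGroup U] [Module F U] [FiniteDimensional F U]
    (X : Submodule F V) (f : V →ₗ[F] U) :
    finrank F X ≤ finrank F (X ⊓ LinearMap.ker f : Submodule F V) + finrank F U := by
  have h₁ := Submodule.finrank_sup_add_finrank_inf_eq X (LinearMap.ker f)
  have h₂ := (X ⊔ LinearMap.ker f).finrank_le
  have h₃ := f.finrank_range_add_finrank_ker
  have h₄ := (LinearMap.range f).finrank_le
  omega

theorem exists_le_forall_eq_zero {V U : Type*} [AddCommGroup V] [Module F V]
    [FiniteDimensional F V] [AddCommGroup U] [Module F U] [FiniteDimensional F U] {n : ℕ}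
    (X : Submodule F V) (f : Fin n → V →ₗ[F] U) :
    ∃ X' ≤ X, finrank F X ≤ finrank F X' + n * finrank F U ∧ ∀ x ∈ X', ∀ i, f i x = 0 :=
  ⟨X ⊓ LinearMap.ker (LinearMap.pi f), inf_le_left,
    by simpa [Module.finrank_pi_fintype] using finrank_le_finrank_inf_ker_add X (LinearMap.pi f),
    fun _ hx i => congrFun (LinearMap.mem_ker.1 hx.2) i⟩

variable [FiniteDimensional F W]

/-- If no nonzero element of `W` is in the kernel of `τ`, then every subspace of `W` has a basis
dual to functionals of the form `τ x y`. -/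
theorem exists_dual_family (τ : V₁ →ₗ[F] V₂ →ₗ[F] W →ₗ[F] F)
    (hτ : ∀ z, (∀ x y, τ x y z = 0) → z = 0) :
    ∀ (n : ℕ) (K : Submodule F W), n ≤ finrank F K →
      ∃ (x : Fin n → V₁) (y : Fin n → V₂) (z : Fin n → W), (∀ i, z i ∈ K) ∧
        ∀ i j, τ (x i) (y i) (z j) = if i = j then 1 else 0
  | 0, _, _ => ⟨Fin.elim0, Fin.elim0, Fin.elim0, fun i => i.elim0, fun i => i.elim0⟩
  | n + 1, K, hK => by
    obtain ⟨w, hwK, hw⟩ := K.exists_mem_ne_zero_of_ne_bot (by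
      rintro rfl
      simp at hK)
    obtain ⟨x₀, y₀, h₀⟩ : ∃ x y, τ x y w ≠ 0 := by
      by_contra! h
      exact hw (hτ w h)
    have hK' := finrank_le_finrank_inf_ker_add K (τ x₀ y₀)
    rw [finrank_self] at hK'
    obtain ⟨x, y, z, hz, hxyz⟩ := exists_dual_family τ hτ n (K ⊓ LinearMap.ker (τ x₀ y₀)) (by omega)
    set w' := (τ x₀ y₀ w)⁻¹ • w
    have hw' : τ x₀ y₀ w' = 1 := by simp [w', h₀]
    have hz₀ : ∀ i, τ x₀ y₀ (z i) = 0 := fun i => (hz i).2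
    refine ⟨Fin.cons x₀ x, Fin.cons y₀ y, Fin.cons (w' - ∑ j, τ (x j) (y j) w' • z j) z, ?_, ?_⟩
    · refine Fin.cases ?_ fun i => (hz i).1
      exact K.sub_mem (K.smul_mem _ hwK) (K.sum_mem fun j _ => K.smul_mem _ (hz j).1)
    · refine Fin.cases (Fin.cases ?_ fun j => ?_) fun i => Fin.cases ?_ fun j => ?_
      · simp [hw', hz₀]
      · simp [hz₀, (Fin.succ_ne_zero j).symm]
      · simp [hxyz, Fin.succ_ne_zero]
      · simp [hxyz]

variable [FiniteDimensional F V₁] [FiniteDimensional F V₂] {τ : V₁ →ₗ[F] V₂ →ₗ[F] W →ₗ[F] F}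
  {B : Submodule F W} {X₀ : Submodule F V₁} {Y₀ : Submodule F V₂} {h : ℕ}

/-- If every `z ∉ B` stays nonzero on all subspaces of small codimension, then a space `K` larger
than `B` has vectors dual to rank one blocks on which `τ` is diagonal. -/
theorem exists_diagonal_family
    (hB : ∀ X ≤ X₀, ∀ Y ≤ Y₀, finrank F V₁ ≤ finrank F X + h → finrank F V₂ ≤ finrank F Y + h →
      ∀ z ∉ B, ∃ x ∈ X, ∃ y ∈ Y, τ x y z ≠ 0) :
    ∀ (n p : ℕ) (X : Submodule F V₁) (Y : Submodule F V₂) (K : Submodule F W), X ≤ X₀ → Y ≤ Y₀ →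
      finrank F V₁ ≤ finrank F X + p → finrank F V₂ ≤ finrank F Y + p →
      p + n * finrank F W ≤ h → finrank F B + n ≤ finrank F K →
      ∃ (x : Fin n → V₁) (y : Fin n → V₂) (z : Fin n → W), (∀ i, x i ∈ X) ∧ (∀ i, y i ∈ Y) ∧
        (∀ i, z i ∈ K) ∧ (∀ i j, i ≠ j → τ (x i) (y j) = 0) ∧
        ∀ i j, τ (x i) (y i) (z j) = if i = j then 1 else 0
  | 0, _, _, _, _, _, _, _, _, _, _ =>
    ⟨Fin.elim0, Fin.elim0, Fin.elim0, fun i => i.elim0, fun i => i.elim0, fun i => i.elim0,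
      fun i => i.elim0, fun i => i.elim0⟩
  | n + 1, p, X, Y, K, hX₀, hY₀, hX, hY, hp, hK => by
    rw [add_mul, one_mul] at hp
    obtain ⟨w, hwK, hw⟩ : ∃ w ∈ K, w ∉ B := by
      by_contra! hKB
      have := Submodule.finrank_mono hKB
      omega
    obtain ⟨x₀, hx₀, y₀, hy₀, h₀⟩ := hB X hX₀ Y hY₀ (by omega) (by omega) w hw
    have hK' := finrank_le_finrank_inf_ker_add K (τ x₀ y₀)
    have hX' := finrank_le_finrank_inf_ker_add X (τ.flip y₀)
    have hY' := finrank_le_finrank_inf_ker_add Y (τ x₀)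
    rw [finrank_self] at hK'
    rw [Subspace.dual_finrank_eq] at hX' hY'
    obtain ⟨x, y, z, hx, hy, hz, hne, hxyz⟩ := exists_diagonal_family hB n (p + finrank F W)
      (X ⊓ LinearMap.ker (τ.flip y₀)) (Y ⊓ LinearMap.ker (τ x₀)) (K ⊓ LinearMap.ker (τ x₀ y₀))
      (inf_le_left.trans hX₀) (inf_le_left.trans hY₀) (by omega) (by omega) (by omega) (by omega)
    set w' := (τ x₀ y₀ w)⁻¹ • w
    have hw' : τ x₀ y₀ w' = 1 := by simp [w', h₀]
    have hz₀ : ∀ i, τ x₀ y₀ (z i) = 0 := fun i => (hz i).2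
    refine ⟨Fin.cons x₀ x, Fin.cons y₀ y, Fin.cons (w' - ∑ j, τ (x j) (y j) w' • z j) z,
      Fin.cases hx₀ fun i => (hx i).1, Fin.cases hy₀ fun i => (hy i).1, ?_, ?_, ?_⟩
    · refine Fin.cases ?_ fun i => (hz i).1
      exact K.sub_mem (K.smul_mem _ hwK) (K.sum_mem fun j _ => K.smul_mem _ (hz j).1)
    · refine Fin.cases (Fin.cases (fun h => (h rfl).elim) fun j _ => (hy j).2) fun i =>
        Fin.cases (fun _ => (hx i).2) fun j hij => hne i j fun h => hij (h ▸ rfl)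
    · refine Fin.cases (Fin.cases ?_ fun j => ?_) fun i => Fin.cases ?_ fun j => ?_
      · simp [hw', hz₀]
      · simp [hz₀, (Fin.succ_ne_zero j).symm]
      · simp [hxyz, Fin.succ_ne_zero]
      · simp [hxyz]

/-- Iterated form of `exists_diagonal_family`: arbitrarily many groups of rank one blocks, each of
which is dual to a basis of a complement of `B`. -/
theorem exists_diagonal_families
    (hB : ∀ X ≤ X₀, ∀ Y ≤ Y₀, finrank F V₁ ≤ finrank F X + h → finrank F V₂ ≤ finrank F Y + h →
      ∀ z ∉ B, ∃ x ∈ X, ∃ y ∈ Y, τ x y z ≠ 0) {t : ℕ} (ht : finrank F B + t = finrank F W) :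
    ∀ (n p : ℕ) (X : Submodule F V₁) (Y : Submodule F V₂), X ≤ X₀ → Y ≤ Y₀ →
      finrank F V₁ ≤ finrank F X + p → finrank F V₂ ≤ finrank F Y + p →
      p + n * (t * finrank F W) ≤ h →
      ∃ (x : Fin n → Fin t → V₁) (y : Fin n → Fin t → V₂) (z : Fin n → Fin t → W),
        (∀ g i, x g i ∈ X) ∧ (∀ g i, y g i ∈ Y) ∧
        (∀ g g' i i', (g, i) ≠ (g', i') → τ (x g i) (y g' i') = 0) ∧
        ∀ g i i', τ (x g i) (y g i) (z g i') = if i = i' then 1 else 0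
  | 0, _, _, _, _, _, _, _, _ =>
    ⟨Fin.elim0, Fin.elim0, Fin.elim0, fun i => i.elim0, fun i => i.elim0, fun i => i.elim0,
      fun i => i.elim0⟩
  | n + 1, p, X, Y, hX₀, hY₀, hX, hY, hp => by
    rw [add_mul, one_mul] at hp
    obtain ⟨x₀, y₀, z₀, hx₀, hy₀, -, hne₀, hxyz₀⟩ := exists_diagonal_family hB t p X Y ⊤ hX₀ hY₀
      hX hY (by omega) (by rw [finrank_top]; exact ht.le)
    obtain ⟨X', hXX', hX', hX'₀⟩ := exists_le_forall_eq_zero X fun i => τ.flip (y₀ i)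
    obtain ⟨Y', hYY', hY', hY'₀⟩ := exists_le_forall_eq_zero Y fun i => τ (x₀ i)
    rw [Subspace.dual_finrank_eq] at hX' hY'
    obtain ⟨x, y, z, hx, hy, hne, hxyz⟩ := exists_diagonal_families hB ht n (p + t * finrank F W)
      X' Y' (hXX'.trans hX₀) (hYY'.trans hY₀) (by omega) (by omega) (by omega)
    refine ⟨Fin.cons x₀ x, Fin.cons y₀ y, Fin.cons z₀ z, Fin.cases hx₀ fun g i => hXX' (hx g i),
      Fin.cases hy₀ fun g i => hYY' (hy g i), ?_, Fin.cases hxyz₀ hxyz⟩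
    refine Fin.cases (Fin.cases ?_ fun g' => ?_) fun g => Fin.cases ?_ fun g' => ?_
    · exact fun i i' hi => hne₀ i i' fun h => hi (h ▸ rfl)
    · exact fun i i' _ => hY'₀ _ (hy g' i') i
    · exact fun i i' _ => hX'₀ _ (hx g i) i'
    · intro i i' hi
      exact hne g g' i i' fun h => hi (by simp_all)

theorem nonempty_blockFamily (hτ : ∀ z, (∀ x y, τ x y z = 0) → z = 0)
    (hB : ∀ X ≤ X₀, ∀ Y ≤ Y₀, finrank F V₁ ≤ finrank F X + h → finrank F V₂ ≤ finrank F Y + h →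
      ∀ z ∉ B, ∃ x ∈ X, ∃ y ∈ Y, τ x y z ≠ 0)
    (hXY : ∀ x ∈ X₀, ∀ y ∈ Y₀, ∀ z ∈ B, τ x y z = 0) {s n t : ℕ}
    (hX : finrank F V₁ ≤ finrank F X₀ + s) (hY : finrank F V₂ ≤ finrank F Y₀ + s)
    (ht : finrank F B + t = finrank F W)
    (hs : s + finrank F B * finrank F W + n * (t * finrank F W) ≤ h) :
    Nonempty (BlockFamily τ (Fin n) (Fin t) (Fin (finrank F B))) := by
  obtain ⟨x₀, y₀, z₀, hz₀, hxyz₀⟩ := exists_dual_family τ hτ _ B le_rfl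
  obtain ⟨X, hXX₀, hX', hX₀⟩ := exists_le_forall_eq_zero X₀ fun i => τ.flip (y₀ i)
  obtain ⟨Y, hYY₀, hY', hY₀⟩ := exists_le_forall_eq_zero Y₀ fun i => τ (x₀ i)
  rw [Subspace.dual_finrank_eq] at hX' hY'
  obtain ⟨x, y, z, hx, hy, hne, hxyz⟩ := exists_diagonal_families hB ht n
    (s + finrank F B * finrank F W) X Y hXX₀ hYY₀ (by omega) (by omega) hs
  exact ⟨{
    x := fun g => Sum.elim (x g) x₀
    y := fun g => Sum.elim (y g) y₀
    z := fun g => Sum.elim (z g) z₀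
    inl_inr := fun g _ i j => hX₀ _ (hx g i) j
    inr_inl := fun _ g i j => hY₀ _ (hy g i) j
    inl_inl := hne
    inl_inl_inr := fun g _ i j => hXY _ (hXX₀ (hx g i)) _ (hYY₀ (hy g i)) _ (hz₀ j)
    inl_diag := hxyz
    inr_diag := fun _ _ _ => hxyz₀ }⟩

/-- A nondegenerate trilinear form that vanishes on two subspaces of codimension at most `s` lives
on a space of bounded dimension. -/
theorem finrank_le_of_forall_eq_zero (hτ : ∀ x, τ x = 0 → x = 0) {X : Submodule F V₁}
    {Y : Submodule F V₂} {s : ℕ} (hX : finrank F V₁ ≤ finrank F X + s)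
    (hY : finrank F V₂ ≤ finrank F Y + s) (hXY : ∀ x ∈ X, ∀ y ∈ Y, τ x y = 0) :
    finrank F V₁ ≤ s * finrank F W + s := by
  obtain ⟨Z, hZ⟩ := Y.exists_isCompl
  have hZs := Submodule.finrank_add_eq_of_isCompl hZ
  have hker := finrank_le_finrank_inf_ker_add (U := Z →ₗ[F] Dual F W) X
    ((LinearMap.lcomp F (Dual F W) Z.subtype).comp τ)
  have hbot : X ⊓ LinearMap.ker ((LinearMap.lcomp F (Dual F W) Z.subtype).comp τ) = ⊥ := by
    refine (Submodule.eq_bot_iff _).2 fun x hx => hτ x (LinearMap.ext fun v => ?_)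
    obtain ⟨y, hy, z, hz, rfl⟩ := Submodule.mem_sup.1 (hZ.sup_eq_top ▸ Submodule.mem_top (x := v))
    have hxz : τ x z = 0 := LinearMap.congr_fun (LinearMap.mem_ker.1 hx.2) ⟨z, hz⟩
    simp [hXY x hx.1 y hy, hxz]
  rw [hbot, finrank_bot, zero_add, finrank_linearMap, Subspace.dual_finrank_eq] at hker
  have := Nat.mul_le_mul_right (finrank F W) (show finrank F Z ≤ s by omega)
  omega

theorem exists_blockFamily (h₁ : ∀ x, τ x = 0 → x = 0) (h₂ : ∀ y, τ.flip y = 0 → y = 0)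
    (h₃ : ∀ z, (∀ x y, τ x y z = 0) → z = 0) (n : ℕ)
    (hn : finrank F W * (finrank F W ^ 2 * (n + 1)) * (finrank F W + 1) <
      max (finrank F V₁) (finrank F V₂)) :
    ∃ t b : ℕ, 0 < t ∧ t + b = finrank F W ∧
      Nonempty (BlockFamily τ (Fin n) (Fin t) (Fin b)) := by
  by_contra! hcon
  set c := finrank F W with hc
  set D := c ^ 2 * (n + 1)
  have key : ∀ j ≤ c, ∃ (B : Submodule F W) (X : Submodule F V₁) (Y : Submodule F V₂),
      finrank F B = j ∧ finrank F V₁ ≤ finrank F X + j * D ∧ finrank F V₂ ≤ finrank F Y + j * D ∧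
        ∀ x ∈ X, ∀ y ∈ Y, ∀ z ∈ B, τ x y z = 0 := by
    intro j
    induction j with
    | zero => exact fun _ => ⟨⊥, ⊤, ⊤, by simp, by simp, by simp, by simp⟩
    | succ j ih =>
      intro hj
      obtain ⟨B, X₀, Y₀, hBj, hX₀, hY₀, hXY⟩ := ih (by omega)
      obtain ⟨X, hX, Y, hY, hXr, hYr, z, hz, hzero⟩ : ∃ X ≤ X₀, ∃ Y ≤ Y₀,
          finrank F V₁ ≤ finrank F X + (j + 1) * D ∧ finrank F V₂ ≤ finrank F Y + (j + 1) * D ∧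
            ∃ z ∉ B, ∀ x ∈ X, ∀ y ∈ Y, τ x y z = 0 := by
        by_contra! hB
        obtain ⟨t, ht⟩ : ∃ t, j + t = c := ⟨c - j, by omega⟩
        refine (hcon t j (by omega) (by omega)).elim' ?_
        subst hBj
        refine (nonempty_blockFamily h₃ hB hXY hX₀ hY₀ ht ?_).some
        have : finrank F B * c + n * (t * c) ≤ D := by
          calc
            _ ≤ c * c + n * (c * c) := by gcongr <;> omega
            _ = D := by ring
        linarith
      refine ⟨B ⊔ F ∙ z, X, Y, ?_, hXr, hYr, ?_⟩
      · rw [Submodule.finrank_sup_span_singleton hz, hBj]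
      · intro x hx y hy w hw
        obtain ⟨u, hu, v, hv, rfl⟩ := Submodule.mem_sup.1 hw
        obtain ⟨a, rfl⟩ := Submodule.mem_span_singleton.1 hv
        simp [hXY x (hX hx) y (hY hy) u hu, hzero x hx y hy]
  obtain ⟨B, X, Y, hB, hX, hY, hXY⟩ := key c le_rfl
  obtain rfl : B = ⊤ := Submodule.eq_top_of_finrank_eq hB
  have hV₁ := finrank_le_of_forall_eq_zero h₁ hX hY fun x hx y hy =>
    LinearMap.ext fun z => hXY x hx y hy z trivial
  have hV₂ := finrank_le_of_forall_eq_zero h₂ hY hX fun y hy x hx =>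
    LinearMap.ext fun z => hXY x hx y hy z trivial
  rw [← hc] at hV₁ hV₂
  rcases lt_max_iff.1 hn with hn | hn <;> nlinarith

end TrilinearForms

section TensorForms

variable {ι₁ ι₂ ι₃ : Type*} [Fintype ι₁] [Fintype ι₂] [Fintype ι₃]

/-- The trilinear form with coefficient array `T`. -/
def trilinearForm (T : ι₁ → ι₂ → ι₃ → F) : (ι₁ → F) →ₗ[F] (ι₂ → F) →ₗ[F] (ι₃ → F) →ₗ[F] F :=
  LinearMap.mk₂ F (fun x y => ∑ i, ∑ j, ∑ k, (x i * y j * T i j k) • LinearMap.proj k)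
    (fun x x' y => by simp [add_mul, add_smul, Finset.sum_add_distrib])
    (fun a x y => by simp [Finset.smul_sum, smul_smul, mul_assoc])
    (fun x y y' => by simp [mul_add, add_mul, add_smul, Finset.sum_add_distrib])
    (fun a x y => by simp [Finset.smul_sum, smul_smul, mul_assoc, mul_left_comm])

theorem trilinearForm_apply (T : ι₁ → ι₂ → ι₃ → F) (x : ι₁ → F) (y : ι₂ → F) (z : ι₃ → F) :
    trilinearForm T x y z = ∑ i, ∑ j, ∑ k, x i * y j * z k * T i j k := by
  simp [trilinearForm, mul_right_comm]

theorem trilinearForm_kronPow (T : ι₁ → ι₂ → ι₃ → F) {m : ℕ} (x : Fin m → ι₁ → F)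
    (y : Fin m → ι₂ → F) (z : Fin m → ι₃ → F) :
    trilinearForm (kronPow T m) (fun v => ∏ s, x s (v s)) (fun v => ∏ s, y s (v s))
      (fun v => ∏ s, z s (v s)) = ∏ s, trilinearForm T (x s) (y s) (z s) := by
  simp only [trilinearForm_apply, kronPow, ← Finset.prod_mul_distrib, Finset.prod_univ_sum,
    Fintype.piFinset_univ]

theorem eq_zero_of_rank_eq_card {m n : Type*} [Fintype m] [Fintype n] {A : Matrix m n F}
    (hA : A.rank = Fintype.card m) {x : m → F} (hx : ∀ j, ∑ i, x i * A i j = 0) : x = 0 := by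
  have hli : LinearIndependent F A.row := by
    rw [linearIndependent_iff_card_eq_finrank_span, ← hA, Matrix.rank_eq_finrank_span_row]
    rfl
  refine funext (Fintype.linearIndependent_iff.1 hli x (funext fun j => ?_))
  simpa [Matrix.row] using hx j

theorem Concise.trilinearForm_left [DecidableEq ι₂] [DecidableEq ι₃] {T : ι₁ → ι₂ → ι₃ → F}
    (hT : Concise T) (x : ι₁ → F) (hx : trilinearForm T x = 0) : x = 0 := by
  refine eq_zero_of_rank_eq_card hT.1 fun p => ?_
  have h := LinearMap.congr_fun (LinearMap.congr_fun hx (Pi.single p.1 1)) (Pi.single p.2 1)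
  simpa [trilinearForm_apply, flattening1, Pi.single_apply] using h

theorem Concise.trilinearForm_middle [DecidableEq ι₁] [DecidableEq ι₃] {T : ι₁ → ι₂ → ι₃ → F}
    (hT : Concise T) (y : ι₂ → F) (hy : (trilinearForm T).flip y = 0) : y = 0 := by
  refine eq_zero_of_rank_eq_card hT.2.1 fun p => ?_
  have h := LinearMap.congr_fun (LinearMap.congr_fun hy (Pi.single p.1 1)) (Pi.single p.2 1)
  simpa [trilinearForm_apply, flattening2, Pi.single_apply] using h

theorem Concise.trilinearForm_right [DecidableEq ι₁] [DecidableEq ι₂] {T : ι₁ → ι₂ → ι₃ → F}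
    (hT : Concise T) (z : ι₃ → F) (hz : ∀ x y, trilinearForm T x y z = 0) : z = 0 := by
  refine eq_zero_of_rank_eq_card hT.2.2 fun p => ?_
  have h := hz (Pi.single p.1 1) (Pi.single p.2 1)
  simpa [trilinearForm_apply, flattening3, Pi.single_apply] using h

theorem Restricts.le_card {T : ι₁ → ι₂ → ι₃ → F} {r : ℕ} (h : Restricts T (unitTensor F r)) :
    r ≤ Fintype.card ι₃ := by
  obtain ⟨L₁, L₂, L₃, hL⟩ := h
  have hli : LinearIndependent F L₃ := by
    refine Fintype.linearIndependent_iff.2 fun g hg a => ?_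
    have hsum : ∑ c, g c * unitTensor F r a a c = trilinearForm T (L₁ a) (L₂ a) (∑ c, g c • L₃ c) := by
      simp [map_sum, hL, trilinearForm_apply]
    simpa [hg, unitTensor] using hsum
  simpa using hli.fintype_card_le_finrank

theorem bddAbove_restricts (T : ι₁ → ι₂ → ι₃ → F) :
    BddAbove {r : ℕ | Restricts T (unitTensor F r)} :=
  ⟨Fintype.card ι₃, fun _ h => h.le_card⟩

theorem subrank_le_card_s2 (T : ι₁ → ι₂ → ι₃ → F) : subrank T ≤ Fintype.card ι₃ :=
  csSup_le' fun _ h => Restricts.le_card h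

theorem card_le_subrank (T : ι₁ → ι₂ → ι₃ → F) {A : Type*} [Fintype A] [DecidableEq A]
    (x : A → ι₁ → F) (y : A → ι₂ → F) (z : A → ι₃ → F)
    (h : ∀ a b c, trilinearForm T (x a) (y b) (z c) = if a = b ∧ b = c then 1 else 0) :
    Fintype.card A ≤ subrank T := by
  refine le_csSup (bddAbove_restricts T) ?_
  let e := (Fintype.equivFin A).symm
  refine ⟨x ∘ e, y ∘ e, z ∘ e, fun a b c => ?_⟩
  simpa [trilinearForm_apply, unitTensor] using (h (e a) (e b) (e c)).symm

end TensorForms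

section Words

variable {I J : Type*}

/-- The positions of a word that carry a letter of the first kind. -/
def leftPositions {m : ℕ} (v : Fin m → I ⊕ J) : Finset (Fin m) :=
  {s | (v s).isLeft}

theorem mem_leftPositions {m : ℕ} {v : Fin m → I ⊕ J} {s : Fin m} :
    s ∈ leftPositions v ↔ (v s).isLeft := by
  simp [leftPositions]

variable [Fintype I] [DecidableEq I] [Fintype J] [DecidableEq J]

/-- Some class of words with a fixed, not too small, number of letters of the first kind contains
all words up to a polynomial factor. -/
theorem exists_card_leftPositions_eq (l : I) (m : ℕ) :
    ∃ k : ℕ, m ≤ Fintype.card (I ⊕ J) * k ∧ Fintype.card (I ⊕ J) ^ m ≤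
      (m + 1) * Fintype.card (I ⊕ J) *
        Fintype.card {v : Fin m → I ⊕ J // (leftPositions v).card = k} := by
  set c := Fintype.card (I ⊕ J) with hc
  let count (v : Fin m → I ⊕ J) (a : I ⊕ J) : ℕ := (Finset.univ.filter fun s => v s = a).card
  let good : Finset (Fin m → I ⊕ J) := {v | m ≤ c * count v (.inl l)}
  have hpop (v : Fin m → I ⊕ J) : ∃ a, m ≤ c * count v a := by
    by_contra! h
    have hsum : ∑ a, count v a = m := by
      simpa [count] using (Finset.card_eq_sum_card_fiberwise (f := v) (s := Finset.univ)
        (t := Finset.univ) (by simp)).symm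
    have := Finset.sum_lt_sum_of_nonempty (s := (Finset.univ : Finset (I ⊕ J)))
      ⟨.inl l, Finset.mem_univ _⟩ fun a _ => h a
    rw [← Finset.mul_sum, hsum] at this
    simp [hc] at this
  choose a ha using hpop
  have hgood : c ^ m ≤ good.card * c := by
    have hmaps : ∀ v ∈ (Finset.univ : Finset (Fin m → I ⊕ J)),
        (Equiv.swap (a v) (.inl l) ∘ v, a v) ∈ good ×ˢ (Finset.univ : Finset (I ⊕ J)) := by
      intro v _
      have : count (Equiv.swap (a v) (.inl l) ∘ v) (.inl l) = count v (a v) := by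
        simp only [count, Function.comp_apply]
        congr 1
        ext s
        simp [Equiv.swap_apply_eq_iff]
      simpa [good, this] using ha v
    have hinj := Finset.card_le_card_of_injOn _ hmaps (by
      intro v _ w _ hvw
      obtain ⟨h₁, h₂⟩ := Prod.mk.inj hvw
      simp only [h₂] at h₁
      exact funext fun s => (Equiv.swap _ _).injective (congrFun h₁ s))
    simpa [hc, Finset.card_product] using hinj
  have hpos : 0 < good.card * c := lt_of_lt_of_le (pow_pos (Fintype.card_pos_iff.2 ⟨.inl l⟩) m) hgood
  have hne : good.Nonempty := Finset.card_pos.1 (Nat.pos_of_mul_pos_right hpos)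
  set t := good.image fun v => (leftPositions v).card
  have ht : t.card ≤ m + 1 := by
    refine (Finset.card_le_card (Finset.image_subset_iff.2 fun v _ => ?_)).trans
      (Finset.card_range (m + 1)).le
    simpa [Nat.lt_succ_iff] using (leftPositions v).card_le_univ
  obtain ⟨k, hkt, hk⟩ : ∃ k ∈ t, good.card ≤
      t.card * (good.filter fun v => (leftPositions v).card = k).card := by
    by_contra! h
    have hsum := Finset.card_eq_sum_card_fiberwise (s := good) (t := t)
      (f := fun v => (leftPositions v).card) fun v hv => Finset.mem_image_of_mem _ hv
    have := Finset.sum_lt_sum_of_nonempty (hne.image _) h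
    rw [← Finset.mul_sum, ← hsum] at this
    simp [t] at this
  obtain ⟨v, hv, rfl⟩ := Finset.mem_image.1 hkt
  refine ⟨(leftPositions v).card, (Finset.mem_filter.1 hv).2.trans
    (Nat.mul_le_mul_left _ (Finset.card_le_card ?_)), ?_⟩
  · intro s hs
    simp_all [mem_leftPositions]
  · rw [Fintype.card_subtype]
    calc
      c ^ m ≤ good.card * c := hgood
      _ ≤ (m + 1) * (Finset.univ.filter fun w : Fin m → I ⊕ J =>
          (leftPositions w).card = (leftPositions v).card).card * c := by
        gcongr
        refine hk.trans (Nat.mul_le_mul ht (Finset.card_le_card ?_))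
        exact Finset.filter_subset_filter _ (Finset.subset_univ _)
      _ = _ := by ring

end Words

namespace BlockFamily

variable {V₁ V₂ W G I J : Type*} [AddCommGroup V₁] [Module F V₁] [AddCommGroup V₂] [Module F V₂]
  [AddCommGroup W] [Module F W] [DecidableEq I] [DecidableEq J]
  {τ : V₁ →ₗ[F] V₂ →ₗ[F] W →ₗ[F] F} (f : BlockFamily τ G I J) {g g' g'' : G} {a b c : I ⊕ J}

theorem apply_self : τ (f.x g a) (f.y g a) (f.z g a) = 1 := by
  cases a <;> simp [f.inl_diag, f.inr_diag]

theorem isLeft_eq (h : τ (f.x g a) (f.y g' b) ≠ 0) : a.isLeft = b.isLeft := by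
  cases a <;> cases b <;> simp [f.inl_inr, f.inr_inl] at h ⊢

theorem eq_of_isLeft (h : τ (f.x g a) (f.y g' b) ≠ 0) (ha : a.isLeft) : g = g' ∧ a = b := by
  have hab := f.isLeft_eq h
  obtain ⟨i, rfl⟩ := Sum.isLeft_iff.1 ha
  obtain ⟨i', rfl⟩ := Sum.isLeft_iff.1 (hab.symm.trans ha)
  by_contra hne
  exact h (f.inl_inl _ _ _ _ fun h => hne (by simpa using h))

theorem isLeft_of_ne_zero (h : τ (f.x g a) (f.y g a) (f.z g' c) ≠ 0) (ha : a.isLeft) :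
    c.isLeft := by
  cases a <;> cases c <;> simp [f.inl_inl_inr] at h ha ⊢

theorem eq_of_not_isLeft (h : τ (f.x g a) (f.y g' a) (f.z g'' c) ≠ 0) (ha : ¬ a.isLeft)
    (hc : ¬ c.isLeft) : a = c := by
  cases a <;> cases c <;> simp [f.inr_diag] at h ha hc ⊢
  exact h

theorem eq_of_ne_zero (h : τ (f.x g a) (f.y g a) (f.z g c) ≠ 0) (hac : a.isLeft = c.isLeft) :
    a = c := by
  cases a <;> cases c <;> simp [f.inr_diag, f.inl_diag] at h hac ⊢ <;> exact h

end BlockFamily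

theorem BlockFamily.card_le_subrank {ι₁ ι₂ ι₃ G I J : Type*} [Fintype ι₁] [Fintype ι₂] [Fintype ι₃]
    [Fintype G] [Nonempty G] [Fintype I] [DecidableEq I] [Fintype J] [DecidableEq J]
    {T : ι₁ → ι₂ → ι₃ → F} (f : BlockFamily (trilinearForm T) G I J) {m k : ℕ} (l : I)
    (hG : Fintype.card (I ⊕ J) ^ m ≤ Fintype.card G ^ k) :
    Fintype.card {v : Fin m → I ⊕ J // (leftPositions v).card = k} ≤ subrank (kronPow T m) := by
  classical
  have hg (S : Finset (Fin m)) : ∃ g : (Fin m → I ⊕ J) → Fin m → G, S.card = k →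
      ∀ u v, (∀ s ∈ S, g u s = g v s) → u = v := by
    by_cases hS : S.card = k
    · obtain ⟨e⟩ : Nonempty ((Fin m → I ⊕ J) ↪ (S → G)) :=
        Function.Embedding.nonempty_of_card_le (by simpa [hS] using hG)
      refine ⟨fun v s => if hs : s ∈ S then e v ⟨s, hs⟩ else Classical.arbitrary G,
        fun _ u v huv => e.injective (funext fun s => ?_)⟩
      simpa using huv s s.2
    · exact ⟨fun _ _ => Classical.arbitrary G, fun h => (hS h).elim⟩
  choose g hg using hg
  let mask (v : Fin m → I ⊕ J) : Fin m → I ⊕ J := fun s => (v s).map (fun _ => l) id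
  let γ (v : Fin m → I ⊕ J) : Fin m → G := g (leftPositions v) (mask v)
  have hγ {u v : Fin m → I ⊕ J} (h₁ : leftPositions u = leftPositions v) (h₂ : mask u = mask v) :
      γ u = γ v := by simp only [γ, h₁, h₂]
  refine Paper.card_le_subrank (A := {v : Fin m → I ⊕ J // (leftPositions v).card = k})
    (kronPow T m) (fun v i => ∏ s, f.x (γ v s) (v.1 s) (i s))
    (fun v i => ∏ s, f.y (γ v s) (v.1 s) (i s)) (fun v i => ∏ s, f.z (γ v s) (v.1 s) (i s)) ?_
  rintro ⟨u, hu⟩ ⟨v, hv⟩ ⟨w, hw⟩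
  rw [trilinearForm_kronPow]
  split_ifs with h
  · obtain ⟨rfl, rfl⟩ : u = v ∧ v = w := by simpa using h
    refine Finset.prod_eq_one fun s _ => ?_
    exact f.apply_self
  · by_contra hprod
    have hne s := Finset.prod_ne_zero_iff.1 hprod s (Finset.mem_univ s)
    have hne₂ s : trilinearForm T (f.x (γ u s) (u s)) (f.y (γ v s) (v s)) ≠ 0 :=
      fun h₀ => hne s (by simp [h₀])
    have hS : leftPositions u = leftPositions v := by
      ext s
      rw [mem_leftPositions, mem_leftPositions, f.isLeft_eq (hne₂ s)]
    have hmask : mask u = mask v := by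
      refine hg (leftPositions u) hu _ _ fun s hs => ?_
      have := (f.eq_of_isLeft (hne₂ s) (mem_leftPositions.1 hs)).1
      simp only [γ] at this
      rwa [← hS] at this
    obtain rfl : u = v := by
      funext s
      by_cases hs : (u s).isLeft
      · exact (f.eq_of_isLeft (hne₂ s) hs).2
      · have h₁ : (u s).map (fun _ => l) id = (v s).map (fun _ => l) id := congrFun hmask s
        have h₂ := f.isLeft_eq (hne₂ s)
        revert hs h₁ h₂
        cases u s <;> cases v s <;> simp
    have hSw : leftPositions u = leftPositions w :=
      Finset.eq_of_subset_of_card_le (fun s hs => mem_leftPositions.2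
        (f.isLeft_of_ne_zero (hne s) (mem_leftPositions.1 hs))) (by rw [hu, hw])
    have hleft (s) : (u s).isLeft = (w s).isLeft := by
      rw [Bool.eq_iff_iff, ← mem_leftPositions, ← mem_leftPositions, hSw]
    have hmask_w : mask u = mask w := by
      funext s
      by_cases hs : (u s).isLeft
      · have h₁ := hleft s
        simp only [mask]
        revert hs h₁
        cases u s <;> cases w s <;> simp
      · have h₁ : u s = w s := f.eq_of_not_isLeft (hne s) hs (by rwa [← hleft s])
        simp only [mask, h₁]
    refine h ⟨rfl, Subtype.ext (funext fun s => f.eq_of_ne_zero (g := γ u s) ?_ (hleft s))⟩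
    simpa only [hγ hSw hmask_w] using hne s

theorem subrank_rpow_le_card {ι₁ ι₂ ι₃ : Type*} [Fintype ι₁] [Fintype ι₂] [Fintype ι₃]
    (T : ι₁ → ι₂ → ι₃ → F) (m : ℕ) :
    (subrank (kronPow T (m + 1)) : ℝ) ^ ((1 : ℝ) / (m + 1)) ≤ Fintype.card ι₃ := by
  have h : (subrank (kronPow T (m + 1)) : ℝ) ≤ (Fintype.card ι₃ : ℝ) ^ (m + 1) := by
    have := subrank_le_card_s2 (kronPow T (m + 1))
    rw [Fintype.card_fun, Fintype.card_fin] at this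
    exact_mod_cast this
  rw [one_div, Real.rpow_inv_le_iff_of_pos (by positivity) (by positivity) (by positivity)]
  exact_mod_cast h

theorem asympSubrank_le_card {ι₁ ι₂ ι₃ : Type*} [Fintype ι₁] [Fintype ι₂] [Fintype ι₃]
    (T : ι₁ → ι₂ → ι₃ → F) : asympSubrank T ≤ Fintype.card ι₃ :=
  ciSup_le (subrank_rpow_le_card T)

theorem subrank_kronPow_le_asympSubrank_pow_s2 {ι₁ ι₂ ι₃ : Type*} [Fintype ι₁] [Fintype ι₂]
    [Fintype ι₃] (T : ι₁ → ι₂ → ι₃ → F) (m : ℕ) :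
    (subrank (kronPow T (m + 1)) : ℝ) ≤ asympSubrank T ^ (m + 1) := by
  have hle : (subrank (kronPow T (m + 1)) : ℝ) ^ ((1 : ℝ) / (m + 1)) ≤ asympSubrank T :=
    le_ciSup (f := fun m : ℕ => (subrank (kronPow T (m + 1)) : ℝ) ^ ((1 : ℝ) / (m + 1)))
      ⟨_, Set.forall_mem_range.2 (subrank_rpow_le_card T)⟩ m
  have h₀ : 0 ≤ asympSubrank T := le_trans (by positivity) hle
  rw [one_div, Real.rpow_inv_le_iff_of_pos (by positivity) h₀ (by positivity)] at hle
  exact_mod_cast hle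

theorem le_asympSubrank_of_pow_le {ι₁ ι₂ ι₃ : Type*} [Fintype ι₁] [Fintype ι₂] [Fintype ι₃]
    (T : ι₁ → ι₂ → ι₃ → F) {c : ℕ} (hc : 0 < c)
    (h : ∀ m : ℕ, c ^ m ≤ (m + 1) * c * subrank (kronPow T m)) : (c : ℝ) ≤ asympSubrank T := by
  by_contra! hlt
  have h₀ : 0 ≤ asympSubrank T := Real.iSup_nonneg fun _ => by positivity
  have hc' : (0 : ℝ) < c := by exact_mod_cast hc
  set r := asympSubrank T / c
  have hr₀ : 0 ≤ r := by positivity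
  have hr₁ : r < 1 := (div_lt_one hc').2 hlt
  have hlim : Filter.Tendsto (fun m : ℕ => (m * r ^ m + r ^ m) * c) Filter.atTop (nhds 0) := by
    simpa using ((tendsto_self_mul_const_pow_of_lt_one hr₀ hr₁).add
      (tendsto_pow_atTop_nhds_zero_of_lt_one hr₀ hr₁)).mul_const (c : ℝ)
  obtain ⟨m, hm, hm₀⟩ :=
    ((hlim.eventually_lt_const one_pos).and (Filter.eventually_gt_atTop 0)).exists
  obtain ⟨m, rfl⟩ : ∃ n, m = n + 1 := ⟨m - 1, by omega⟩
  have h₁ : (c : ℝ) ^ (m + 1) ≤ ((m + 1 : ℕ) + 1) * c * subrank (kronPow T (m + 1)) := by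
    exact_mod_cast h (m + 1)
  have h₂ : (c : ℝ) ^ (m + 1) ≤ ((m + 1 : ℕ) + 1) * c * asympSubrank T ^ (m + 1) :=
    h₁.trans (by gcongr ?_ * ?_; exact subrank_kronPow_le_asympSubrank_pow_s2 T m)
  have h₃ : asympSubrank T = r * c := by simp [r, hc'.ne']
  rw [h₃, mul_pow, ← mul_assoc] at h₂
  have h₄ : 1 ≤ ((m + 1 : ℕ) + 1) * c * r ^ (m + 1) :=
    le_of_mul_le_mul_right (by rwa [one_mul]) (pow_pos hc' (m + 1))
  linarith

/-- For every `c ≥ 2` there is `N(c)` such that every concise tensor of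
format `(n1, n2, c)` with `max {n1, n2} > N(c)` has asymptotic subrank exactly `c`. -/
theorem asympSubrank_eq_of_narrow (F : Type*) [Field F] :
    ∀ c : ℕ, 2 ≤ c → ∃ N : ℕ, ∀ n1 n2 : ℕ, N < max n1 n2 →
      ∀ T : Fin n1 → Fin n2 → Fin c → F, Concise T → asympSubrank T = (c : ℝ) := by
  intro c hc
  refine ⟨c * (c ^ 2 * (c ^ c + 1)) * (c + 1), fun n1 n2 hn T hT => le_antisymm ?_ ?_⟩
  · simpa using asympSubrank_le_card T
  obtain ⟨t, b, ht, htb, ⟨f⟩⟩ := exists_blockFamily hT.trilinearForm_left hT.trilinearForm_middle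
    hT.trilinearForm_right (c ^ c) (by simpa using hn)
  have hcard : Fintype.card (Fin t ⊕ Fin b) = c := by simpa using htb
  have : NeZero (c ^ c) := ⟨by positivity⟩
  refine le_asympSubrank_of_pow_le T (by omega) fun m => ?_
  obtain ⟨k, hmk, hk⟩ := exists_card_leftPositions_eq (J := Fin b) (⟨0, ht⟩ : Fin t) m
  rw [hcard] at hmk hk
  refine hk.trans (Nat.mul_le_mul_left _ (f.card_le_subrank ⟨0, ht⟩ ?_))
  rw [hcard, Fintype.card_fin, ← pow_mul]
  exact Nat.pow_le_pow_right (by omega) hmk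

end Paper
end
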